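/- arXiv:1303.2459 — 3 statements merged into one kernel-verified Lean document; each statement's English description precedes it below -/
import Mathlib

section
/- Let Ω ⊂ ℝⁿ be a bounded strictly convex open domain with smooth boundary, V : Ω̄ → ℝ a smooth potential, and φ₀ the ground state of L = −Δ + V with Dirichlet boundary condition on Ω. Then for every ε > 0 there exists η₁ > 0 such that for all x, y ∈ Ω with 0 < |x − y| ≤ η₁, one has ⟨∇log φ₀(x) − ∇log φ₀(y), (x − y)/|x − y|⟩ ≤ ε. -/
open Metric Set
open scoped RealInnerProductSpace

/-- The Laplacian of a function on Euclidean space, `Δ f x = ∑ i ∂²f/∂xᵢ²`. -/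
noncomputable def lap {n : ℕ} (f : EuclideanSpace ℝ (Fin n) → ℝ)
    (x : EuclideanSpace ℝ (Fin n)) : ℝ :=
  ∑ i : Fin n, fderiv ℝ (fun y => fderiv ℝ f y (EuclideanSpace.single i 1)) x
    (EuclideanSpace.single i 1)

lemma lap_eq_sum {n : ℕ} {f : EuclideanSpace ℝ (Fin n) → ℝ}
    {f' : EuclideanSpace ℝ (Fin n) → (EuclideanSpace ℝ (Fin n) →L[ℝ] ℝ)}
    {f'' : EuclideanSpace ℝ (Fin n) →L[ℝ] (EuclideanSpace ℝ (Fin n) →L[ℝ] ℝ)}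
    {x : EuclideanSpace ℝ (Fin n)}
    (h1 : ∀ᶠ y in nhds x, HasFDerivAt f (f' y) y) (h2 : HasFDerivAt f' f'' x) :
    lap f x = ∑ i : Fin n, f'' (EuclideanSpace.single i 1) (EuclideanSpace.single i 1) := by
  unfold lap
  refine Finset.sum_congr rfl fun i _ => ?_
  have h3 : (fun y => fderiv ℝ f y (EuclideanSpace.single i 1)) =ᶠ[nhds x]
      fun y => f' y (EuclideanSpace.single i 1) := by
    filter_upwards [h1] with y hy
    rw [hy.fderiv]
  rw [h3.fderiv_eq]
  have := (h2.clm_apply (hasFDerivAt_const (EuclideanSpace.single i (1:ℝ)) x)).fderiv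
  rw [this]
  simp

lemma IsLocalMin.second_fderiv_nonneg {F : Type*} [NormedAddCommGroup F] [NormedSpace ℝ F]
    {f : F → ℝ} {f' : F → (F →L[ℝ] ℝ)} {f'' : F →L[ℝ] (F →L[ℝ] ℝ)} {x : F}
    (hm : IsLocalMin f x)
    (h1 : ∀ᶠ y in nhds x, HasFDerivAt f (f' y) y) (h2 : HasFDerivAt f' f'' x) (e : F) :
    0 ≤ f'' e e := by
  by_contra! hneg
  have hl : ∀ t : ℝ, HasDerivAt (fun t : ℝ => x + t • e) e t := fun t => by
    simpa using ((hasDerivAt_id t).smul_const e).const_add x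
  have hc : Filter.Tendsto (fun t : ℝ => x + t • e) (nhds 0) (nhds x) := by
    simpa using (hl 0).continuousAt.tendsto
  have hg : ∀ᶠ t in nhds (0:ℝ), HasDerivAt (fun t : ℝ => f (x + t • e)) (f' (x + t • e) e) t := by
    filter_upwards [hc.eventually h1] with t ht
    exact ht.comp_hasDerivAt t (hl t)
  have hd : deriv (fun t : ℝ => f (x + t • e)) =ᶠ[nhds 0] fun t => f' (x + t • e) e := by
    filter_upwards [hg] with t ht using ht.deriv
  have hg2 : HasDerivAt (fun t : ℝ => f' (x + t • e) e) (f'' e e) 0 := by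
    have h2' : HasFDerivAt f' f'' (x + (0:ℝ) • e) := by simpa using h2
    have h3 := h2'.comp_hasDerivAt (0:ℝ) (hl 0)
    simpa using h3.clm_apply (hasDerivAt_const (0:ℝ) e)
  have hmin : IsLocalMin (fun t : ℝ => f (x + t • e)) 0 := by
    have := hc.eventually hm
    filter_upwards [this] with t ht
    simpa using ht
  have hdd : deriv (deriv (fun t : ℝ => f (x + t • e))) 0 = f'' e e := by
    rw [hd.deriv_eq, hg2.deriv]
  have hmax := isLocalMax_of_deriv_deriv_neg (f := fun t : ℝ => f (x + t • e)) (x₀ := 0)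
    (by rw [hdd]; exact hneg) hmin.deriv_eq_zero hg.self_of_nhds.continuousAt
  have hconst : (fun t : ℝ => f (x + t • e)) =ᶠ[nhds 0] fun _ => f x := by
    filter_upwards [hmin, hmax] with t a b
    simp only [zero_smul, add_zero] at a b
    exact le_antisymm b a
  have hz : deriv (deriv (fun t : ℝ => f (x + t • e))) 0 = 0 := by
    rw [hconst.deriv.deriv_eq]
    simp
  linarith

set_option maxSynthPendingDepth 3 in
lemma exists_second_order_data {F : Type*} [NormedAddCommGroup F] [NormedSpace ℝ F]
    {f : F → ℝ} {S : Set F} (hf : ContDiffOn ℝ (⊤ : ℕ∞) f S) (hS : UniqueDiffOn ℝ S) :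
    ∃ (D1 : F → (F →L[ℝ] ℝ)) (D2 : F → (F →L[ℝ] (F →L[ℝ] ℝ))),
      (∀ x ∈ S, HasFDerivWithinAt f (D1 x) S x) ∧ (∀ x ∈ S, HasFDerivWithinAt D1 (D2 x) S x) ∧
      ContDiffOn ℝ (⊤ : ℕ∞) D1 S ∧ ContDiffOn ℝ (⊤ : ℕ∞) D2 S := by
  have h1 : ContDiffOn ℝ (⊤ : ℕ∞) (fderivWithin ℝ f S) S := hf.fderivWithin hS (by simp)
  refine ⟨fderivWithin ℝ f S, fderivWithin ℝ (fderivWithin ℝ f S) S, fun x hx => ?_, fun x hx => ?_,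
    h1, h1.fderivWithin hS (by simp)⟩
  · exact (hf.differentiableOn (by simp) x hx).hasFDerivWithinAt
  · exact (h1.differentiableOn (by simp) x hx).hasFDerivWithinAt

set_option maxSynthPendingDepth 3 in
lemma exists_smooth_bounds {F : Type*} [NormedAddCommGroup F] [NormedSpace ℝ F]
    {f : F → ℝ} {K : Set F} (hf : ContDiffOn ℝ (⊤ : ℕ∞) f K) (hK : IsCompact K)
    (hconv : Convex ℝ K) (hint : (interior K).Nonempty) :
    ∃ (D1 : F → (F →L[ℝ] ℝ)) (D2 : F → (F →L[ℝ] (F →L[ℝ] ℝ))) (M : ℝ), 0 < M ∧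
      (∀ x ∈ K, HasFDerivWithinAt f (D1 x) K x) ∧ (∀ x ∈ K, HasFDerivWithinAt D1 (D2 x) K x) ∧
      (∀ x ∈ K, ‖D1 x‖ ≤ M) ∧ (∀ x ∈ K, ‖D2 x‖ ≤ M) ∧
      (∀ x ∈ K, ∀ y ∈ K, ‖D1 x - D1 y‖ ≤ M * ‖x - y‖) ∧
      (∀ x ∈ K, ∀ y ∈ K, ‖D2 x - D2 y‖ ≤ M * ‖x - y‖) := by
  have hu := uniqueDiffOn_convex hconv hint
  obtain ⟨D1, D2, h1, h2, c1, c2⟩ := exists_second_order_data hf hu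
  have c3 : ContDiffOn ℝ (⊤ : ℕ∞) (fderivWithin ℝ D2 K) K := c2.fderivWithin hu (by simp)
  obtain ⟨M1, hM1⟩ := hK.exists_bound_of_continuousOn c1.continuousOn
  obtain ⟨M2, hM2⟩ := hK.exists_bound_of_continuousOn c2.continuousOn
  obtain ⟨M3, hM3⟩ := hK.exists_bound_of_continuousOn c3.continuousOn
  refine ⟨D1, D2, max 1 (max M1 (max M2 M3)), by positivity, h1, h2, ?_, ?_, ?_, ?_⟩
  · exact fun x hx => (hM1 x hx).trans (by simp)
  · exact fun x hx => (hM2 x hx).trans (by simp)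
  · intro x hx y hy
    exact hconv.norm_image_sub_le_of_norm_hasFDerivWithin_le h2
      (fun x hx => (hM2 x hx).trans (by simp)) hy hx
  · intro x hx y hy
    exact hconv.norm_image_sub_le_of_norm_hasFDerivWithin_le
      (fun x hx => (c2.differentiableOn (by simp) x hx).hasFDerivWithinAt)
      (fun x hx => (hM3 x hx).trans (by simp)) hy hx

section
variable {F G : Type*} [NormedAddCommGroup F] [NormedSpace ℝ F]
  [NormedAddCommGroup G] [NormedSpace ℝ G]

lemma HasFDerivWithinAt.hasDerivWithinAt_segment {f : F → G} {L : F →L[ℝ] G} {K : Set F} {x h : F}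
    {t : ℝ} (hf : HasFDerivWithinAt f L K (x + t • h))
    (hm : ∀ s ∈ Icc (0:ℝ) 1, x + s • h ∈ K) :
    HasDerivWithinAt (fun s : ℝ => f (x + s • h)) (L h) (Icc 0 1) t := by
  have hl : HasDerivWithinAt (fun t : ℝ => x + t • h) h (Icc 0 1) t := by
    simpa using (((hasDerivAt_id t).smul_const h).const_add x).hasDerivWithinAt
  exact hf.comp_hasDerivWithinAt t hl hm

lemma monotoneOn_Icc_of_hasDerivWithinAt_nonneg {g g' : ℝ → ℝ}
    (hg : ∀ t ∈ Icc (0:ℝ) 1, HasDerivWithinAt g (g' t) (Icc 0 1) t)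
    (h0 : ∀ t ∈ Icc (0:ℝ) 1, 0 ≤ g' t) : MonotoneOn g (Icc 0 1) :=
  monotoneOn_of_hasDerivWithinAt_nonneg (convex_Icc 0 1)
    (fun t ht => (hg t ht).continuousWithinAt)
    (fun t ht => (hg t (interior_subset ht)).mono interior_subset)
    (fun t ht => h0 t (interior_subset ht))

lemma taylor_lower_bound {f : F → ℝ} {D1 : F → (F →L[ℝ] ℝ)} {D2 : F → (F →L[ℝ] (F →L[ℝ] ℝ))}
    {K : Set F} (hK : Convex ℝ K)
    (h1 : ∀ x ∈ K, HasFDerivWithinAt f (D1 x) K x) (h2 : ∀ x ∈ K, HasFDerivWithinAt D1 (D2 x) K x)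
    {x h : F} (hx : x ∈ K) (hxh : x + h ∈ K) {m : ℝ}
    (hm : ∀ t ∈ Icc (0:ℝ) 1, m ≤ D2 (x + t • h) h h) :
    f x + D1 x h + m / 2 ≤ f (x + h) := by
  have hs : ∀ t ∈ Icc (0:ℝ) 1, x + t • h ∈ K := fun t ht => hK.add_smul_mem hx hxh ht
  have hd1 : ∀ t ∈ Icc (0:ℝ) 1, HasDerivWithinAt (fun s : ℝ => f (x + s • h))
      (D1 (x + t • h) h) (Icc 0 1) t :=
    fun t ht => (h1 _ (hs t ht)).hasDerivWithinAt_segment hs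
  have hd2 : ∀ t ∈ Icc (0:ℝ) 1, HasDerivWithinAt (fun s : ℝ => D1 (x + s • h) h)
      (D2 (x + t • h) h h) (Icc 0 1) t := fun t ht => by
    have := (h2 _ (hs t ht)).hasDerivWithinAt_segment hs
    simpa using this.clm_apply (hasDerivWithinAt_const t (Icc (0:ℝ) 1) h)
  have hmono1 : MonotoneOn (fun s : ℝ => D1 (x + s • h) h - m * s) (Icc 0 1) :=
    monotoneOn_Icc_of_hasDerivWithinAt_nonneg (g' := fun t => D2 (x + t • h) h h - m)
      (fun t ht => by
        exact ((hd2 t ht).sub ((hasDerivWithinAt_id t _).const_mul m)).congr_deriv (by simp))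
      (fun t ht => sub_nonneg.2 (hm t ht))
  have hmono2 : MonotoneOn (fun s : ℝ => f (x + s • h) - (D1 x h * s + m / 2 * s ^ 2)) (Icc 0 1) :=
    monotoneOn_Icc_of_hasDerivWithinAt_nonneg (g' := fun t => D1 (x + t • h) h - (D1 x h + m * t))
      (fun t ht => by
        have := (hd1 t ht).sub (((hasDerivWithinAt_id t (Icc (0:ℝ) 1)).const_mul (D1 x h)).add
          (((hasDerivWithinAt_id t (Icc (0:ℝ) 1)).pow 2).const_mul (m / 2)))
        refine this.congr_deriv ?_
        simp only [id_eq]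
        push_cast
        ring)
      (fun t ht => by
        have := hmono1 (left_mem_Icc.2 zero_le_one) ht ht.1
        simp at this
        linarith)
  have := hmono2 (left_mem_Icc.2 zero_le_one) (right_mem_Icc.2 zero_le_one) zero_le_one
  simp at this
  linarith

lemma IsPreconnected.exists_mem_frontier {X : Type*} [TopologicalSpace X] {A Ω : Set X} (hA : IsPreconnected A) (hΩ : IsOpen Ω)
    {a b : X} (ha : a ∈ A) (hb : b ∈ A) (haΩ : a ∉ Ω) (hbΩ : b ∈ Ω) :
    ∃ q ∈ A, q ∈ frontier Ω := by
  by_contra! hcon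
  have hcl : ∀ q ∈ A, q ∉ Ω → q ∉ closure Ω := fun q hq hn hc =>
    hcon q hq (by rw [hΩ.frontier_eq]; exact ⟨hc, hn⟩)
  obtain ⟨q, -, hq1, hq2⟩ := hA Ω (closure Ω)ᶜ hΩ isClosed_closure.isOpen_compl
    (fun q hq => by
      by_cases h : q ∈ Ω
      · exact Or.inl h
      · exact Or.inr (hcl q hq h))
    ⟨b, hb, hbΩ⟩ ⟨a, ha, hcl a ha haΩ⟩
  exact hq2 (subset_closure hq1)

lemma ball_subset_of_mem_closure {Ω : Set F} (hΩ : IsOpen Ω) (hconv : Convex ℝ Ω) {p z : F} {r : ℝ}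
    (hp : p ∈ closure Ω) (hz : ball z r ⊆ Ω) {t : ℝ} (ht : t ∈ Ioc (0:ℝ) 1) :
    ball (p + t • (z - p)) (t * r) ⊆ Ω := by
  intro v hv
  have ht0 := ht.1
  have hk : z + t⁻¹ • (v - (p + t • (z - p))) ∈ Ω := by
    apply hz
    rw [mem_ball_iff_norm, add_sub_cancel_left, norm_smul, norm_inv, Real.norm_of_nonneg ht0.le]
    rw [mem_ball_iff_norm] at hv
    rwa [inv_mul_lt_iff₀ ht0]
  have := hconv.add_smul_sub_mem_interior' hp (by rwa [hΩ.interior_eq]) ht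
  rw [hΩ.interior_eq] at this
  convert this using 1
  rw [add_sub_right_comm, smul_add, smul_smul, mul_inv_cancel₀ ht0.ne', one_smul]
  abel

lemma mul_le_inward_deriv {Ω : Set F} (hΩ : IsOpen Ω) (hconv : Convex ℝ Ω) {f : F → ℝ}
    {L : F →L[ℝ] ℝ} {p z : F} {r c : ℝ} (hc : 0 ≤ c)
    (hf : HasFDerivWithinAt f L (closure Ω) p) (hp : p ∈ frontier Ω) (hfp : f p = 0)
    (hlow : ∀ x ∈ Ω, c * infDist x (frontier Ω) ≤ f x)
    (hr : 0 < r) (hz : ball z r ⊆ Ω) : c * r ≤ L (z - p) := by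
  have hpc : p ∈ closure Ω := frontier_subset_closure hp
  have hzΩ : z ∈ Ω := hz (mem_ball_self hr)
  have hs : ∀ t ∈ Icc (0:ℝ) 1, p + t • (z - p) ∈ closure Ω := fun t ht =>
    hconv.closure.add_smul_sub_mem hpc (subset_closure hzΩ) ht
  have hd : HasDerivWithinAt (fun s : ℝ => f (p + s • (z - p))) (L (z - p)) (Icc 0 1) 0 := by
    have h0 : HasFDerivWithinAt f L (closure Ω) (p + (0:ℝ) • (z - p)) := by simpa using hf
    exact h0.hasDerivWithinAt_segment hs
  have hd' := hd.mono (Ioc_subset_Icc_self)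
  rw [hasDerivWithinAt_iff_tendsto_slope' (by simp)] at hd'
  have : (nhdsWithin (0:ℝ) (Ioc 0 1)).NeBot := by
    rw [← mem_closure_iff_nhdsWithin_neBot, closure_Ioc zero_ne_one]
    simp
  refine ge_of_tendsto hd' ?_
  filter_upwards [self_mem_nhdsWithin] with t ht
  have hb := ball_subset_of_mem_closure hΩ hconv hpc hz ht
  have hmem : p + t • (z - p) ∈ Ω := hb (mem_ball_self (mul_pos ht.1 hr))
  have hdist : t * r ≤ infDist (p + t • (z - p)) (frontier Ω) := by
    rw [le_infDist ⟨p, hp⟩]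
    intro y hy
    by_contra! hlt
    have hy' : y ∈ Ω := hb (by rwa [mem_ball, dist_comm])
    rw [hΩ.frontier_eq] at hy
    exact hy.2 hy'
  have h1 := hlow _ hmem
  have h2 := mul_le_mul_of_nonneg_left hdist hc
  simp only [slope_def_field, zero_smul, add_zero, hfp, sub_zero]
  rw [le_div_iff₀ ht.1]
  linarith

set_option maxHeartbeats 1000000 in
lemma second_deriv_tangent_nonpos {Ω : Set F} (hΩ : IsOpen Ω) (hconv : Convex ℝ Ω)
    (hne : Ω.Nonempty) {f : F → ℝ}
    {D1 : F → (F →L[ℝ] ℝ)} {D2 : F → (F →L[ℝ] (F →L[ℝ] ℝ))} {M : ℝ} (hM : 0 ≤ M)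
    (h1 : ∀ x ∈ closure Ω, HasFDerivWithinAt f (D1 x) (closure Ω) x)
    (h2 : ∀ x ∈ closure Ω, HasFDerivWithinAt D1 (D2 x) (closure Ω) x)
    (hL : ∀ x ∈ closure Ω, ∀ y ∈ closure Ω, ‖D2 x - D2 y‖ ≤ M * ‖x - y‖)
    (hbd : ∀ x ∈ frontier Ω, f x = 0) {p : F} (hp : p ∈ frontier Ω)
    (hin : ∀ z ∈ Ω, 0 < D1 p (z - p)) {e : F} (he : D1 p e = 0) : D2 p e e ≤ 0 := by
  by_contra! ha
  obtain ⟨z, hz⟩ := hne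
  obtain ⟨r, hr, hzr⟩ := Metric.isOpen_iff.1 hΩ z hz
  have hpc : p ∈ closure Ω := frontier_subset_closure hp
  set w := z - p with hw
  set κ := (‖e‖ + 1) / r with hκ
  have hκ0 : 0 < κ := by positivity
  have hc : 0 < D1 p w := hin z hz
  set c := D1 p w with hcdef
  set N := ‖e‖ + κ * ‖w‖ with hN
  have hN0 : 0 ≤ N := by positivity
  set C1 := ‖D2 p‖ * (2 * ‖e‖ * ‖w‖ + κ * ‖w‖ ^ 2) with hC1
  obtain ⟨s, hs0, hsκ, hsC, hsN⟩ : ∃ s : ℝ, 0 < s ∧ s * κ < 1 ∧ s * C1 < 2 * c ∧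
      s * (M * N ^ 3) < D2 p e e := by
    have ht : ∀ X Y : ℝ, 0 < Y → ∀ᶠ s in nhdsWithin (0:ℝ) (Ioi 0), s * X < Y := fun X Y hY => by
      have h : Filter.Tendsto (fun s : ℝ => s * X) (nhdsWithin 0 (Ioi 0)) (nhds 0) := by
        have : Filter.Tendsto (fun s : ℝ => s * X) (nhds 0) (nhds (0 * X)) :=
          (continuous_id.mul continuous_const).tendsto 0
        rw [zero_mul] at this
        exact this.mono_left nhdsWithin_le_nhds
      exact h.eventually (gt_mem_nhds hY)
    have hpos : ∀ᶠ s in nhdsWithin (0:ℝ) (Ioi 0), 0 < s := self_mem_nhdsWithin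
    have := hpos.and
      ((ht κ 1 one_pos).and ((ht C1 (2 * c) (by positivity)).and (ht (M * N ^ 3) _ ha)))
    obtain ⟨s, h1, h2, h3, h4⟩ := Filter.Eventually.exists this
    exact ⟨s, h1, h2, h3, h4⟩
  have hout : p + s • (e + (0:ℝ) • w) ∉ Ω := fun hmem => by
    have := hin _ hmem
    simp [he] at this
  have hinn : p + s • (e + κ • w) ∈ Ω := by
    have hsk : s * κ ∈ Ioc (0:ℝ) 1 := ⟨by positivity, hsκ.le⟩
    apply ball_subset_of_mem_closure hΩ hconv hpc hzr hsk
    rw [mem_ball_iff_norm, smul_add, smul_smul]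
    have : p + (s • e + (s * κ) • w) - (p + (s * κ) • (z - p)) = s • e := by
      rw [hw]; abel
    rw [this, norm_smul, Real.norm_of_nonneg hs0.le, mul_assoc]
    have : κ * r = ‖e‖ + 1 := by rw [hκ]; field_simp
    rw [this]
    nlinarith
  have hpre : IsPreconnected ((fun σ : ℝ => p + s • (e + σ • w)) '' Icc 0 κ) :=
    isPreconnected_Icc.image _ (by fun_prop)
  obtain ⟨_, ⟨σ, hσ, rfl⟩, hq⟩ := hpre.exists_mem_frontier hΩ
    ⟨0, left_mem_Icc.2 hκ0.le, rfl⟩ ⟨κ, right_mem_Icc.2 hκ0.le, rfl⟩ hout hinn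
  obtain ⟨hσ0, hσκ⟩ := hσ
  simp only at hq
  have hv : ‖e + σ • w‖ ≤ N := by
    refine (norm_add_le _ _).trans ?_
    rw [norm_smul, Real.norm_of_nonneg hσ0]
    exact add_le_add le_rfl (mul_le_mul_of_nonneg_right hσκ (norm_nonneg _))
  set v := e + σ • w with hvdef
  have hB : D2 p e e - σ * C1 ≤ D2 p v v := by
    have hop : ∀ a b : F, |D2 p a b| ≤ ‖D2 p‖ * ‖a‖ * ‖b‖ := fun a b => (D2 p).le_opNorm₂ a b
    have h1 := (abs_le.1 (hop e w)).1
    have h2 := (abs_le.1 (hop w e)).1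
    have h3 := (abs_le.1 (hop w w)).1
    have hexp : D2 p v v = D2 p e e + σ * (D2 p e w + D2 p w e + σ * D2 p w w) := by
      simp [hvdef]; ring
    have h4 : -(κ * (‖D2 p‖ * ‖w‖ * ‖w‖)) ≤ σ * D2 p w w := by
      have h5 : σ * (‖D2 p‖ * ‖w‖ * ‖w‖) ≤ κ * (‖D2 p‖ * ‖w‖ * ‖w‖) := by gcongr
      nlinarith
    have h6 : -C1 ≤ D2 p e w + D2 p w e + σ * D2 p w w := by
      rw [hC1]; nlinarith
    rw [hexp]
    nlinarith
  have hT := taylor_lower_bound hconv.closure h1 h2 hpc (frontier_subset_closure hq)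
    (m := s ^ 2 * (D2 p e e - σ * C1 - s * (M * N ^ 3))) (fun t ht => by
      have hmem : p + t • s • v ∈ closure Ω :=
        hconv.closure.add_smul_mem hpc (frontier_subset_closure hq) ht
      have hLp := hL _ hmem _ hpc
      have hnorm : ‖p + t • s • v - p‖ ≤ s * N := by
        rw [add_sub_cancel_left, norm_smul, norm_smul, Real.norm_of_nonneg ht.1,
          Real.norm_of_nonneg hs0.le]
        have : s * ‖v‖ ≤ s * N := by gcongr
        have h0 : 0 ≤ s * ‖v‖ := by positivity
        nlinarith [ht.2]
      have hle : |(D2 (p + t • s • v) - D2 p) v v| ≤ s * (M * N ^ 3) := by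
        calc |(D2 (p + t • s • v) - D2 p) v v| ≤ ‖D2 (p + t • s • v) - D2 p‖ * ‖v‖ * ‖v‖ :=
              (D2 (p + t • s • v) - D2 p).le_opNorm₂ v v
          _ ≤ (M * (s * N)) * N * N := by
              gcongr
              exact hLp.trans (by gcongr)
          _ = s * (M * N ^ 3) := by ring
      have := (abs_le.1 hle).1
      simp only [sub_apply] at this
      simp only [map_smul, smul_apply, smul_eq_mul]
      have hs2 : 0 ≤ s ^ 2 := by positivity
      nlinarith)
  rw [hbd _ hp, hbd _ hq] at hT
  have hDv : D1 p (s • v) = s * (σ * c) := by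
    simp [hvdef, he, hcdef]
  rw [hDv] at hT
  have hA : 0 ≤ s * σ * (2 * c - s * C1) := mul_nonneg (by positivity) (by linarith)
  have hBp : 0 < s ^ 2 * (D2 p e e - s * (M * N ^ 3)) := mul_pos (by positivity) (by linarith)
  nlinarith

end

lemma fderiv_infDist_apply_le {F : Type*} [NormedAddCommGroup F] [NormedSpace ℝ F]
    {C : Set F} {x p : F} (hp : p ∈ C) (hxp : infDist x C = dist x p) {L : F →L[ℝ] ℝ}
    (hL : HasFDerivAt (fun y => infDist y C) L x) : L (p - x) ≤ -‖p - x‖ := by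
  have hl : HasDerivAt (fun t : ℝ => x + t • (p - x)) (p - x) 0 := by
    simpa using ((hasDerivAt_id (0:ℝ)).smul_const (p - x)).const_add x
  have hL' : HasFDerivAt (fun y => infDist y C) L (x + (0:ℝ) • (p - x)) := by simpa using hL
  have hd := (hL'.comp_hasDerivAt (0:ℝ) hl).hasDerivWithinAt (s := Ioc 0 1)
  rw [hasDerivWithinAt_iff_tendsto_slope' (by simp)] at hd
  have : (nhdsWithin (0:ℝ) (Ioc 0 1)).NeBot := by
    rw [← mem_closure_iff_nhdsWithin_neBot, closure_Ioc zero_ne_one]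
    simp
  refine le_of_tendsto hd ?_
  filter_upwards [self_mem_nhdsWithin] with t ht
  have h1 : infDist (x + t • (p - x)) C ≤ (1 - t) * ‖p - x‖ := by
    refine (infDist_le_dist_of_mem hp).trans (le_of_eq ?_)
    rw [dist_eq_norm, ← norm_neg]
    have : -(x + t • (p - x) - p) = (1 - t) • (p - x) := by
      rw [sub_smul, one_smul]; abel
    rw [this, norm_smul, Real.norm_of_nonneg (by linarith [ht.2])]
  simp only [slope_def_field, Function.comp, zero_smul, add_zero, hxp, sub_zero]
  rw [div_le_iff₀ ht.1, dist_comm, dist_eq_norm]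
  linarith

lemma one_le_sum_sq_single {n : ℕ} (L : EuclideanSpace ℝ (Fin n) →L[ℝ] ℝ)
    {v : EuclideanSpace ℝ (Fin n)} (hv : v ≠ 0) (hLv : L v ≤ -‖v‖) :
    1 ≤ ∑ i : Fin n, L (EuclideanSpace.single i 1) ^ 2 := by
  have hexp : L v = ∑ i : Fin n, v i * L (EuclideanSpace.single i 1) := by
    conv_lhs => rw [← (EuclideanSpace.basisFun (Fin n) ℝ).sum_repr v]
    simp
  have hcs := Finset.sum_mul_sq_le_sq_mul_sq Finset.univ (fun i => v i)
    (fun i => L (EuclideanSpace.single i 1))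
  rw [← hexp, ← EuclideanSpace.real_norm_sq_eq] at hcs
  have hpos : 0 < ‖v‖ := norm_pos_iff.2 hv
  have h1 : ‖v‖ ^ 2 ≤ L v ^ 2 := by nlinarith
  have h2 : 0 < ‖v‖ ^ 2 := by positivity
  by_contra! hlt
  nlinarith

set_option maxSynthPendingDepth 3 in
lemma barrier_second_deriv {F : Type*} [NormedAddCommGroup F] [NormedSpace ℝ F]
    {u d : F → ℝ} {u' d' : F → (F →L[ℝ] ℝ)} {u'' d'' : F →L[ℝ] (F →L[ℝ] ℝ)} {x : F} (ε k : ℝ)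
    (hu1 : ∀ᶠ y in nhds x, HasFDerivAt u (u' y) y) (hu2 : HasFDerivAt u' u'' x)
    (hd1 : ∀ᶠ y in nhds x, HasFDerivAt d (d' y) y) (hd2 : HasFDerivAt d' d'' x)
    (hm : IsLocalMin (fun y => u y - ε * (d y + k * d y ^ 2)) x) (e : F) :
    ε * ((1 + 2 * k * d x) * d'' e e + 2 * k * d' x e ^ 2) ≤ u'' e e := by
  have h1 : ∀ᶠ y in nhds x, HasFDerivAt (fun y => u y - ε * (d y + k * d y ^ 2))
      (u' y - ε • ((1 + 2 * k * d y) • d' y)) y := by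
    filter_upwards [hu1, hd1] with y a b
    refine (a.sub ((b.add ((b.pow 2).const_mul k)).const_mul ε)).congr_fderiv ?_
    ext z
    simp
    ring
  have hs : HasFDerivAt (fun y => 1 + 2 * k * d y) ((2 * k) • d' x) x :=
    (hd1.self_of_nhds.const_mul (2 * k)).const_add 1
  have h2 := hu2.sub ((hs.smul hd2).const_smul ε)
  have h3 := hm.second_fderiv_nonneg h1 h2 e
  simp at h3
  nlinarith

set_option maxSynthPendingDepth 3 in
set_option maxHeartbeats 1000000 in
/-- Hopf's lemma in quantitative form, with barrier `d + k * d ^ 2`, where `d` is the distance to the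
boundary. -/
lemma exists_mul_infDist_le {n : ℕ} {Ω : Set (EuclideanSpace ℝ (Fin n))}
    (hΩopen : IsOpen Ω) (hΩne : Ω.Nonempty) (hΩbdd : Bornology.IsBounded Ω)
    (hΩconv : Convex ℝ Ω) (hfr : (frontier Ω).Nonempty)
    (hΩsmooth : ∃ r₀ > 0, ContDiffOn ℝ (⊤ : ℕ∞) (fun x => Metric.infDist x (frontier Ω))
      {x ∈ closure Ω | Metric.infDist x (frontier Ω) ≤ r₀})
    {q φ : EuclideanSpace ℝ (Fin n) → ℝ} {M : ℝ} (hM : 0 ≤ M) (hq : ∀ x ∈ Ω, q x ≤ M)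
    (hφsmooth : ContDiffOn ℝ (⊤ : ℕ∞) φ (closure Ω))
    (hφpos : ∀ x ∈ Ω, 0 < φ x) (hφbd : ∀ x ∈ frontier Ω, φ x = 0)
    (hφ : ∀ x ∈ Ω, lap φ x = q x * φ x) :
    ∃ c > 0, ∀ x ∈ Ω, c * infDist x (frontier Ω) ≤ φ x := by
  obtain ⟨r₀, hr₀, hsm⟩ := hΩsmooth
  have hKc : IsCompact (closure Ω) := hΩbdd.isCompact_closure
  have hKu : UniqueDiffOn ℝ (closure Ω) := uniqueDiffOn_convex hΩconv.closure
    (hΩne.mono (hΩopen.subset_interior_iff.2 subset_closure))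
  set d : EuclideanSpace ℝ (Fin n) → ℝ := fun x => infDist x (frontier Ω) with hd
  have hdcont : Continuous d := continuous_infDist_pt _
  have hd0 : ∀ x, 0 ≤ d x := fun x => infDist_nonneg
  have hdfr : ∀ x ∈ frontier Ω, d x = 0 := fun x hx => infDist_zero_of_mem hx
  have hfro : frontier Ω = closure Ω \ Ω := hΩopen.frontier_eq
  have hinΩ : ∀ x ∈ closure Ω, 0 < d x → x ∈ Ω := fun x hx hdx => by
    by_contra hn
    exact hdx.ne' (hdfr x (by rw [hfro]; exact ⟨hx, hn⟩))
  have hSu : UniqueDiffOn ℝ (closure Ω ∩ {x | d x < r₀}) :=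
    hKu.inter (isOpen_lt hdcont continuous_const)
  obtain ⟨d1, d2, hd1, hd2, -, hcd2⟩ := exists_second_order_data
    (hsm.mono (fun x hx => ⟨hx.1, le_of_lt hx.2⟩ :
      closure Ω ∩ {x | d x < r₀} ⊆ {x ∈ closure Ω | infDist x (frontier Ω) ≤ r₀})) hSu
  obtain ⟨u1, u2, hu1, hu2, -, -⟩ := exists_second_order_data hφsmooth hKu
  have hTc : IsCompact (closure Ω ∩ {x | d x ≤ r₀ / 2}) :=
    hKc.inter_right (isClosed_le hdcont continuous_const)
  have hTS : closure Ω ∩ {x | d x ≤ r₀ / 2} ⊆ closure Ω ∩ {x | d x < r₀} := fun x hx =>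
    ⟨hx.1, lt_of_le_of_lt hx.2 (half_lt_self hr₀)⟩
  obtain ⟨A₀, hA₀⟩ := hTc.exists_bound_of_continuousOn (hcd2.continuousOn.mono hTS)
  set A := max 0 ((n:ℝ) * A₀) with hA
  have hAn : 0 ≤ A := le_max_left _ _
  have hlapd : ∀ x ∈ closure Ω ∩ {x | d x ≤ r₀ / 2},
      -A ≤ ∑ i : Fin n, d2 x (EuclideanSpace.single i 1) (EuclideanSpace.single i 1) := by
    intro x hx
    have h1 : ∀ i ∈ Finset.univ, -A₀ ≤
        d2 x (EuclideanSpace.single (i : Fin n) 1) (EuclideanSpace.single i 1) := fun i _ => by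
      have := (d2 x).le_opNorm₂ (EuclideanSpace.single i (1:ℝ)) (EuclideanSpace.single i 1)
      simp only [PiLp.norm_single, norm_one, mul_one] at this
      exact (abs_le.1 (this.trans (hA₀ x hx))).1
    have h2 := Finset.card_nsmul_le_sum _ _ _ h1
    simp only [Finset.card_univ, Fintype.card_fin, nsmul_eq_mul] at h2
    have := le_max_right 0 ((n:ℝ) * A₀)
    linarith
  set k := A + M * r₀ + 1 with hk
  have hk1 : 1 ≤ k := by nlinarith [mul_nonneg hM hr₀.le]
  obtain ⟨δ, hδ0, hδr, hδk⟩ : ∃ δ > 0, δ ≤ r₀ / 2 ∧ 2 * k * δ ≤ 1 := by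
    refine ⟨min (r₀ / 2) (1 / (2 * k)), by positivity, min_le_left _ _, ?_⟩
    have := min_le_right (r₀ / 2) (1 / (2 * k))
    rw [le_div_iff₀ (by positivity)] at this
    linarith
  obtain ⟨m, hm0, hm⟩ : ∃ m > 0, ∀ x ∈ closure Ω ∩ {x | δ ≤ d x}, m ≤ φ x := by
    have hc : IsCompact (closure Ω ∩ {x | δ ≤ d x}) :=
      hKc.inter_right (isClosed_le continuous_const hdcont)
    rcases (closure Ω ∩ {x | δ ≤ d x}).eq_empty_or_nonempty with he | hne
    · exact ⟨1, one_pos, by simp [he]⟩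
    · obtain ⟨x, hx, hmin⟩ := hc.exists_isMinOn hne (hφsmooth.continuousOn.mono inter_subset_left)
      exact ⟨φ x, hφpos x (hinΩ x hx.1 (hδ0.trans_le hx.2)), hmin⟩
  obtain ⟨R, hR⟩ := hKc.exists_bound_of_continuousOn hdcont.continuousOn
  set ε := m / (2 * δ) with hε
  have hε0 : 0 < ε := by positivity
  have hw2 : ∀ x, d x ≤ δ → d x + k * d x ^ 2 ≤ 2 * d x := fun x hx => by
    have := hd0 x
    have h3 : k * d x ≤ k * δ := by gcongr
    nlinarith
  have hnear : ∀ x ∈ closure Ω ∩ {x | d x ≤ δ}, 0 ≤ φ x - ε * (d x + k * d x ^ 2) := by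
    have hc : IsCompact (closure Ω ∩ {x | d x ≤ δ}) :=
      hKc.inter_right (isClosed_le hdcont continuous_const)
    have hcont : ContinuousOn (fun x => φ x - ε * (d x + k * d x ^ 2))
        (closure Ω ∩ {x | d x ≤ δ}) :=
      (hφsmooth.continuousOn.mono inter_subset_left).sub (by fun_prop)
    obtain ⟨p, hp⟩ := hfr
    obtain ⟨x, hx, hmin⟩ := hc.exists_isMinOn
      ⟨p, frontier_subset_closure hp, by simpa [hdfr p hp] using hδ0.le⟩ hcont
    suffices h : 0 ≤ φ x - ε * (d x + k * d x ^ 2) from fun y hy => h.trans (hmin hy)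
    by_contra! hneg
    have hxΩ : x ∈ Ω := by
      by_contra hn
      have hxf : x ∈ frontier Ω := by rw [hfro]; exact ⟨hx.1, hn⟩
      simp [hφbd x hxf, hdfr x hxf] at hneg
    have hxδ : d x < δ := by
      refine lt_of_le_of_ne hx.2 fun heq => ?_
      have h1 := hm x ⟨hx.1, heq.ge⟩
      have h2 := hw2 x hx.2
      have h3 : ε * (d x + k * d x ^ 2) ≤ ε * (2 * δ) := by
        rw [heq] at h2 ⊢; gcongr
      have h4 : ε * (2 * δ) = m := by rw [hε]; field_simp
      linarith
    have hΩn : ∀ᶠ y in nhds x, y ∈ Ω := hΩopen.mem_nhds hxΩ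
    have hδn : ∀ᶠ y in nhds x, d y < δ :=
      (isOpen_lt hdcont continuous_const).mem_nhds hxδ
    have hKn : ∀ y ∈ Ω, closure Ω ∈ nhds y := fun y hy =>
      Filter.mem_of_superset (hΩopen.mem_nhds hy) subset_closure
    have hSn : ∀ y ∈ Ω, d y < δ → closure Ω ∩ {x | d x < r₀} ∈ nhds y := fun y hy hyd =>
      Filter.inter_mem (hKn y hy)
        ((isOpen_lt hdcont continuous_const).mem_nhds (show d y < r₀ by linarith))
    have hlm : IsLocalMin (fun x => φ x - ε * (d x + k * d x ^ 2)) x := by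
      filter_upwards [hΩn, hδn] with y hy hyd
      exact hmin ⟨subset_closure hy, hyd.le⟩
    have eu1 : ∀ᶠ y in nhds x, HasFDerivAt φ (u1 y) y := by
      filter_upwards [hΩn] with y hy
      exact (hu1 y (subset_closure hy)).hasFDerivAt (hKn y hy)
    have eu2 : HasFDerivAt u1 (u2 x) x := (hu2 x (subset_closure hxΩ)).hasFDerivAt (hKn x hxΩ)
    have ed1 : ∀ᶠ y in nhds x, HasFDerivAt d (d1 y) y := by
      filter_upwards [hΩn, hδn] with y hy hyd
      exact (hd1 y (mem_of_mem_nhds (hSn y hy hyd))).hasFDerivAt (hSn y hy hyd)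
    have ed2 : HasFDerivAt d1 (d2 x) x :=
      (hd2 x (mem_of_mem_nhds (hSn x hxΩ hxδ))).hasFDerivAt (hSn x hxΩ hxδ)
    have hsum := Finset.sum_le_sum fun (i : Fin n) (_ : i ∈ Finset.univ) =>
      barrier_second_deriv ε k eu1 eu2 ed1 ed2 hlm (EuclideanSpace.single i 1)
    rw [← lap_eq_sum eu1 eu2, ← Finset.mul_sum, Finset.sum_add_distrib, ← Finset.mul_sum,
      ← Finset.mul_sum, hφ x hxΩ] at hsum
    have hgrad : 1 ≤ ∑ i : Fin n, d1 x (EuclideanSpace.single i 1) ^ 2 := by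
      obtain ⟨p, hp, hxp⟩ := isClosed_frontier.exists_infDist_eq_dist ⟨p, hp⟩ x
      refine one_le_sum_sq_single (d1 x) (v := p - x) (fun h0 => ?_)
        (fderiv_infDist_apply_le hp hxp ed1.self_of_nhds)
      rw [sub_eq_zero] at h0
      rw [h0, hfro] at hp
      exact hp.2 hxΩ
    have hl := hlapd x ⟨hx.1, by simp only [mem_ofPred_eq]; linarith⟩
    have hdx := hd0 x
    set S2 := ∑ i : Fin n, d2 x (EuclideanSpace.single i 1) (EuclideanSpace.single i 1)
    set S1 := ∑ i : Fin n, d1 x (EuclideanSpace.single i 1) ^ 2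
    have b1 : -(2 * A) ≤ (1 + 2 * k * d x) * S2 := by
      have : 2 * k * d x ≤ 1 := le_trans (by gcongr) hδk
      have h0 : 0 ≤ 2 * k * d x := by positivity
      nlinarith
    have b2 : 2 * k ≤ 2 * k * S1 := by nlinarith
    have b3 : q x * φ x ≤ M * (ε * (2 * d x)) := by
      have hφx := hφpos x hxΩ
      have : φ x ≤ ε * (2 * d x) :=
        le_trans (by linarith) (mul_le_mul_of_nonneg_left (hw2 x hx.2) hε0.le)
      calc q x * φ x ≤ M * φ x := by gcongr; exact hq x hxΩ
        _ ≤ _ := by gcongr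
    have b4 : M * (2 * d x) ≤ M * r₀ := by
      gcongr
      linarith
    have b5 : ε * (2 * k - 2 * A) ≤ ε * (M * r₀) := by
      calc ε * (2 * k - 2 * A) ≤ ε * ((1 + 2 * k * d x) * S2 + 2 * k * S1) := by
            gcongr; linarith
        _ ≤ M * (ε * (2 * d x)) := hsum.trans b3
        _ = ε * (M * (2 * d x)) := by ring
        _ ≤ _ := by gcongr
    have b6 := le_of_mul_le_mul_left b5 hε0
    nlinarith [mul_nonneg hM hr₀.le]
  refine ⟨min ε (m / (|R| + 1)), by positivity, fun x hx => ?_⟩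
  have hdx := hd0 x
  change _ * d x ≤ _
  rcases le_total (d x) δ with h | h
  · have h1 := hnear x ⟨subset_closure hx, h⟩
    have h2 : min ε (m / (|R| + 1)) * d x ≤ ε * d x := by gcongr; exact min_le_left _ _
    have h3 : 0 ≤ ε * (k * d x ^ 2) := by positivity
    linarith
  · have h1 := hm x ⟨subset_closure hx, h⟩
    have h2 : d x ≤ |R| + 1 := by
      have := hR x (subset_closure hx)
      have h5 := le_abs_self R
      rw [Real.norm_of_nonneg hdx] at this
      linarith
    calc min ε (m / (|R| + 1)) * d x ≤ m / (|R| + 1) * (|R| + 1) := by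
          gcongr; exact min_le_right _ _
      _ = m := by field_simp
      _ ≤ φ x := h1

set_option maxHeartbeats 1000000 in
/-- A positive function vanishing at least linearly on the boundary of a convex domain has
logarithm with Hessian bounded above. -/
lemma exists_log_hessian_bound {F : Type*} [NormedAddCommGroup F] [NormedSpace ℝ F]
    [FiniteDimensional ℝ F] {Ω : Set F} (hΩ : IsOpen Ω) (hne : Ω.Nonempty)
    (hbdd : Bornology.IsBounded Ω) (hconv : Convex ℝ Ω) (hfr : (frontier Ω).Nonempty) {f : F → ℝ}
    {D1 : F → (F →L[ℝ] ℝ)} {D2 : F → (F →L[ℝ] (F →L[ℝ] ℝ))} {M c₀ : ℝ} (hM : 0 < M) (hc₀ : 0 < c₀)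
    (h1 : ∀ x ∈ closure Ω, HasFDerivWithinAt f (D1 x) (closure Ω) x)
    (h2 : ∀ x ∈ closure Ω, HasFDerivWithinAt D1 (D2 x) (closure Ω) x)
    (hB1 : ∀ x ∈ closure Ω, ‖D1 x‖ ≤ M) (hB2 : ∀ x ∈ closure Ω, ‖D2 x‖ ≤ M)
    (hL1 : ∀ x ∈ closure Ω, ∀ y ∈ closure Ω, ‖D1 x - D1 y‖ ≤ M * ‖x - y‖)
    (hL2 : ∀ x ∈ closure Ω, ∀ y ∈ closure Ω, ‖D2 x - D2 y‖ ≤ M * ‖x - y‖)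
    (hbd : ∀ x ∈ frontier Ω, f x = 0) (hpos : ∀ x ∈ Ω, 0 < f x)
    (hlow : ∀ x ∈ Ω, c₀ * infDist x (frontier Ω) ≤ f x) :
    ∃ C ≥ 0, ∀ x ∈ Ω, ∀ e, f x * D2 x e e - D1 x e ^ 2 ≤ C * ‖e‖ ^ 2 * f x ^ 2 := by
  have : ProperSpace F := FiniteDimensional.proper ℝ F
  obtain ⟨z, hz⟩ := hne
  obtain ⟨r, hr, hzr⟩ := Metric.isOpen_iff.1 hΩ z hz
  obtain ⟨W, hW⟩ : ∃ W, ∀ p ∈ closure Ω, ‖z - p‖ ≤ W :=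
    hbdd.isCompact_closure.exists_bound_of_continuousOn (by fun_prop)
  have hW0 : 0 ≤ W := (norm_nonneg _).trans (hW z (subset_closure hz))
  have hin : ∀ p ∈ frontier Ω, ∀ z ∈ Ω, 0 < D1 p (z - p) := fun p hp z hz => by
    obtain ⟨r, hr, hzr⟩ := Metric.isOpen_iff.1 hΩ z hz
    exact (mul_pos hc₀ hr).trans_le (mul_le_inward_deriv hΩ hconv hc₀.le
      (h1 p (frontier_subset_closure hp)) hp (hbd p hp) hlow hr hzr)
  set c := c₀ * r with hc
  have hc0 : 0 < c := mul_pos hc₀ hr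
  set Q := M * W * (2 + M * W / c) / c with hQ
  have hQ0 : 0 ≤ Q := by positivity
  refine ⟨Q ^ 2 / 4 + (Q * M + M) / c₀, by positivity, fun x hx e => ?_⟩
  obtain ⟨p, hp, hxp⟩ := isClosed_frontier.exists_infDist_eq_dist hfr x
  have hpc : p ∈ closure Ω := frontier_subset_closure hp
  have hxc : x ∈ closure Ω := subset_closure hx
  have hfx := hpos x hx
  set δ := ‖x - p‖ with hδ
  have hδ0 : 0 ≤ δ := norm_nonneg _
  have hδf : δ ≤ f x / c₀ := by
    rw [le_div_iff₀ hc₀, hδ, ← dist_eq_norm, ← hxp, mul_comm]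
    exact hlow x hx
  set w := z - p with hw
  have hwW : ‖w‖ ≤ W := hW p hpc
  have hDw : c ≤ D1 p w := mul_le_inward_deriv hΩ hconv hc₀.le (h1 p hpc) hp (hbd p hp) hlow hr hzr
  have hDw0 : 0 < D1 p w := hc0.trans_le hDw
  set τ := D1 p e with hτ
  set t := D1 x e with ht
  have hτt : |τ| ≤ |t| + M * δ * ‖e‖ := by
    have h3 : |(D1 x - D1 p) e| ≤ M * δ * ‖e‖ :=
      ((D1 x - D1 p).le_opNorm e).trans (by gcongr; exact hL1 x hxc p hpc)
    have h4 : τ = t - (D1 x - D1 p) e := by simp [hτ, ht]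
    rw [h4]
    exact (abs_sub _ _).trans (by linarith)
  have hτM : |τ| ≤ M * ‖e‖ := ((D1 p).le_opNorm e).trans (by gcongr; exact hB1 p hpc)
  set α := τ / D1 p w with hα
  have hατ : |α| ≤ |τ| / c := by
    rw [hα, abs_div, abs_of_pos hDw0]
    gcongr
  have hαe : |α| * ‖w‖ ≤ M * W / c * ‖e‖ := by
    calc |α| * ‖w‖ ≤ (M * ‖e‖ / c) * W := by
          gcongr
          exact hατ.trans (by gcongr)
      _ = _ := by ring
  have hop : ∀ a b : F, |D2 p a b| ≤ M * ‖a‖ * ‖b‖ := fun a b =>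
    ((D2 p).le_opNorm₂ a b).trans (by gcongr; exact hB2 p hpc)
  have htan : D2 p (e - α • w) (e - α • w) ≤ 0 :=
    second_deriv_tangent_nonpos hΩ hconv ⟨z, hz⟩ hM.le h1 h2 hL2 hbd hp (hin p hp)
      (by simp [hα, ← hτ, hDw0.ne'])
  have he' : ‖e - α • w‖ ≤ (1 + M * W / c) * ‖e‖ := by
    refine (norm_sub_le _ _).trans ?_
    rw [norm_smul, Real.norm_eq_abs]
    linarith
  have hp2 : D2 p e e ≤ Q * |τ| * ‖e‖ := by
    have hexp : D2 p e e = D2 p (e - α • w) (e - α • w)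
        + α * (D2 p (e - α • w) w + D2 p w e) := by
      simp only [map_sub, map_smul, sub_apply, smul_apply, smul_eq_mul]
      ring
    have h3 : |D2 p (e - α • w) w + D2 p w e| ≤ M * W * (2 + M * W / c) * ‖e‖ := by
      calc |D2 p (e - α • w) w + D2 p w e| ≤ |D2 p (e - α • w) w| + |D2 p w e| := abs_add_le _ _
        _ ≤ M * ((1 + M * W / c) * ‖e‖) * W + M * W * ‖e‖ := by
            refine add_le_add ((hop _ _).trans ?_) ((hop _ _).trans ?_) <;> gcongr
        _ = _ := by ring
    have h4 : α * (D2 p (e - α • w) w + D2 p w e) ≤ Q * |τ| * ‖e‖ := by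
      calc α * (D2 p (e - α • w) w + D2 p w e)
          ≤ |α| * |D2 p (e - α • w) w + D2 p w e| := by rw [← abs_mul]; exact le_abs_self _
        _ ≤ (|τ| / c) * (M * W * (2 + M * W / c) * ‖e‖) := by gcongr
        _ = _ := by rw [hQ]; ring
    linarith
  have hx2 : D2 x e e ≤ D2 p e e + M * δ * ‖e‖ * ‖e‖ := by
    have h3 : (D2 x - D2 p) e e ≤ M * δ * ‖e‖ * ‖e‖ :=
      (le_abs_self _).trans (((D2 x - D2 p).le_opNorm₂ e e).trans
        (by gcongr; exact hL2 x hxc p hpc))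
    simp only [sub_apply] at h3
    linarith
  have hfin : D2 x e e ≤ Q * |t| * ‖e‖ + (Q * M + M) * (f x / c₀) * ‖e‖ ^ 2 := by
    have h3 : Q * |τ| * ‖e‖ ≤ Q * (|t| + M * δ * ‖e‖) * ‖e‖ := by gcongr
    have h4 : (Q * M + M) * δ * ‖e‖ ^ 2 ≤ (Q * M + M) * (f x / c₀) * ‖e‖ ^ 2 := by gcongr
    linarith
  have h5 := mul_le_mul_of_nonneg_left hfin hfx.le
  have h6 : f x * (Q * |t| * ‖e‖) ≤ t ^ 2 + Q ^ 2 / 4 * ‖e‖ ^ 2 * f x ^ 2 := by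
    rw [← sq_abs t]
    nlinarith [sq_nonneg (|t| - Q / 2 * ‖e‖ * f x)]
  have h7 : f x * ((Q * M + M) * (f x / c₀) * ‖e‖ ^ 2)
      = (Q * M + M) / c₀ * ‖e‖ ^ 2 * f x ^ 2 := by ring
  linarith

lemma log_deriv_sub_le {F : Type*} [NormedAddCommGroup F] [NormedSpace ℝ F]
    {Ω : Set F} (hconv : Convex ℝ Ω) {f : F → ℝ}
    {D1 : F → (F →L[ℝ] ℝ)} {D2 : F → (F →L[ℝ] (F →L[ℝ] ℝ))} {C : ℝ}
    (h1 : ∀ x ∈ Ω, HasFDerivAt f (D1 x) x) (h2 : ∀ x ∈ Ω, HasFDerivAt D1 (D2 x) x)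
    (hpos : ∀ x ∈ Ω, 0 < f x)
    (hC : ∀ x ∈ Ω, ∀ e, f x * D2 x e e - D1 x e ^ 2 ≤ C * ‖e‖ ^ 2 * f x ^ 2)
    {x y : F} (hx : x ∈ Ω) (hy : y ∈ Ω) :
    D1 x (x - y) / f x - D1 y (x - y) / f y ≤ C * ‖x - y‖ ^ 2 := by
  set h := x - y with hh
  have hs : ∀ t ∈ Icc (0:ℝ) 1, y + t • h ∈ Ω := fun t ht => hconv.add_smul_sub_mem hy hx ht
  have hd1 : ∀ t ∈ Icc (0:ℝ) 1, HasDerivWithinAt (fun s : ℝ => f (y + s • h))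
      (D1 (y + t • h) h) (Icc 0 1) t :=
    fun t ht => (h1 _ (hs t ht)).hasFDerivWithinAt.hasDerivWithinAt_segment hs
  have hd2 : ∀ t ∈ Icc (0:ℝ) 1, HasDerivWithinAt (fun s : ℝ => D1 (y + s • h) h)
      (D2 (y + t • h) h h) (Icc 0 1) t := fun t ht => by
    have := (h2 _ (hs t ht)).hasFDerivWithinAt.hasDerivWithinAt_segment hs
    simpa using this.clm_apply (hasDerivWithinAt_const t (Icc (0:ℝ) 1) h)
  have hmono := monotoneOn_Icc_of_hasDerivWithinAt_nonneg
    (g := fun s : ℝ => C * ‖h‖ ^ 2 * s - D1 (y + s • h) h / f (y + s • h))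
    (fun t ht => (((hasDerivWithinAt_id t _).const_mul (C * ‖h‖ ^ 2)).sub
      ((hd2 t ht).div (hd1 t ht) (hpos _ (hs t ht)).ne')))
    (fun t ht => by
      have hp := hpos _ (hs t ht)
      have := hC _ (hs t ht) h
      rw [sub_nonneg, div_le_iff₀ (by positivity)]
      linarith)
  have := hmono (left_mem_Icc.2 zero_le_one) (right_mem_Icc.2 zero_le_one) zero_le_one
  simp only [zero_smul, add_zero, mul_zero, one_smul, mul_one, hh, add_sub_cancel] at this
  rw [← hh] at this
  linarith

/-- **Near-diagonal estimate.**  For the ground state `φ₀` of `-Δ + V` with Dirichlet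
boundary condition on a bounded strictly convex smooth domain: for every `ε > 0` there is
`η₁ > 0` such that `⟨∇log φ₀(x) - ∇log φ₀(y), (x-y)/|x-y|⟩ ≤ ε` whenever `x, y ∈ Ω` and
`0 < |x - y| ≤ η₁`. -/
theorem near_diagonal_estimate
    {n : ℕ} {Ω : Set (EuclideanSpace ℝ (Fin n))}
    (hΩopen : IsOpen Ω) (hΩne : Ω.Nonempty) (hΩbdd : Bornology.IsBounded Ω)
    (hΩconv : StrictConvex ℝ Ω)
    (hΩsmooth : ∃ r₀ > 0, ContDiffOn ℝ (⊤ : ℕ∞) (fun x => Metric.infDist x (frontier Ω))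
      {x ∈ closure Ω | Metric.infDist x (frontier Ω) ≤ r₀})
    {V φ₀ : EuclideanSpace ℝ (Fin n) → ℝ} {lam₀ : ℝ}
    (hV : ContDiffOn ℝ (⊤ : ℕ∞) V (closure Ω))
    (hφ₀smooth : ContDiffOn ℝ (⊤ : ℕ∞) φ₀ (closure Ω))
    (hφ₀pos : ∀ x ∈ Ω, 0 < φ₀ x)
    (hφ₀bd : ∀ x ∈ frontier Ω, φ₀ x = 0)
    (hφ₀eig : ∀ x ∈ Ω, -lap φ₀ x + V x * φ₀ x = lam₀ * φ₀ x) :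
    ∀ ε > (0 : ℝ), ∃ η₁ > (0 : ℝ), ∀ x ∈ Ω, ∀ y ∈ Ω, x ≠ y → ‖x - y‖ ≤ η₁ →
      ⟪gradient (fun z => Real.log (φ₀ z)) x - gradient (fun z => Real.log (φ₀ z)) y,
          (‖x - y‖)⁻¹ • (x - y)⟫ ≤ ε := by
  intro ε hε
  rcases subsingleton_or_nontrivial (EuclideanSpace ℝ (Fin n)) with hsub | hnt
  · exact ⟨1, one_pos, fun x _ y _ hxy => absurd (Subsingleton.elim x y) hxy⟩
  have hconv : Convex ℝ Ω := hΩconv.convex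
  have hfr : (frontier Ω).Nonempty := nonempty_frontier_iff.2 ⟨hΩne, fun h =>
    NormedSpace.unbounded_univ ℝ (EuclideanSpace ℝ (Fin n)) (h ▸ hΩbdd)⟩
  have hKc : IsCompact (closure Ω) := hΩbdd.isCompact_closure
  obtain ⟨D1, D2, M, hM, h1, h2, hB1, hB2, hL1, hL2⟩ := exists_smooth_bounds hφ₀smooth hKc
    hconv.closure (hΩne.mono (hΩopen.subset_interior_iff.2 subset_closure))
  obtain ⟨R, hR⟩ := hKc.exists_bound_of_continuousOn
    (hV.continuousOn.sub (continuousOn_const (c := lam₀)))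
  obtain ⟨c₀, hc₀, hlow⟩ := exists_mul_infDist_le hΩopen hΩne hΩbdd hconv hfr hΩsmooth
    (q := fun x => V x - lam₀) (abs_nonneg R)
    (fun x hx => (le_abs_self _).trans ((hR x (subset_closure hx)).trans (le_abs_self R)))
    hφ₀smooth hφ₀pos hφ₀bd (fun x hx => by linarith [hφ₀eig x hx])
  obtain ⟨C, hC0, hC⟩ := exists_log_hessian_bound hΩopen hΩne hΩbdd hconv hfr hM hc₀ h1 h2 hB1 hB2
    hL1 hL2 hφ₀bd hφ₀pos hlow
  have hKn : ∀ y ∈ Ω, closure Ω ∈ nhds y := fun y hy =>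
    Filter.mem_of_superset (hΩopen.mem_nhds hy) subset_closure
  have e1 : ∀ x ∈ Ω, HasFDerivAt φ₀ (D1 x) x := fun x hx =>
    (h1 x (subset_closure hx)).hasFDerivAt (hKn x hx)
  have e2 : ∀ x ∈ Ω, HasFDerivAt D1 (D2 x) x := fun x hx =>
    (h2 x (subset_closure hx)).hasFDerivAt (hKn x hx)
  have hgrad : ∀ x ∈ Ω, ∀ v, ⟪gradient (fun z => Real.log (φ₀ z)) x, v⟫ = D1 x v / φ₀ x := by
    intro x hx v
    rw [gradient, InnerProductSpace.toDual_symm_apply,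
      ((e1 x hx).log (hφ₀pos x hx).ne').fderiv]
    simp [div_eq_inv_mul]
  refine ⟨ε / (C + 1), by positivity, fun x hx y hy hxy hη => ?_⟩
  have hpos : 0 < ‖x - y‖ := norm_pos_iff.2 (sub_ne_zero.2 hxy)
  have hmain := log_deriv_sub_le hconv e1 e2 hφ₀pos hC hx hy
  rw [real_inner_smul_right, inner_sub_left, hgrad x hx, hgrad y hy, inv_mul_le_iff₀ hpos]
  rw [le_div_iff₀ (by positivity)] at hη
  nlinarith
end

section
/- Let Ω ⊂ ℝⁿ be a bounded strictly convex open domain with smooth boundary, V : Ω̄ → ℝ a smooth potential, φ₀ the ground state of L = −Δ + V with Dirichlet boundary condition on Ω, with ground state energy λ₀. Let u₁ : ℝ₊ × Ω̄ → ℝ be a smooth solution of the heat equation with potential ∂u/∂t = Δu − Vu on ℝ₊ × Ω with u = 0 on ℝ₊ × ∂Ω, and let u₀(t,x) = e^{−λ₀ t}φ₀(x), which also solves this equation. Then v := u₁/u₀ extends to a smooth function on ℝ₊ × Ω̄ and satisfies the drift heat equation ∂v/∂t = Δv + 2⟨∇log φ₀, ∇v⟩ on ℝ₊ × Ω. -/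
open Metric Set
open scoped RealInnerProductSpace

section ParametricIntegral

universe u

theorem continuousOn_parametric_integral_Icc {X F : Type*} [TopologicalSpace X]
    [NormedAddCommGroup F] [NormedSpace ℝ F] {T : Set X} {K : X × ℝ → F}
    (hK : ContinuousOn K (T ×ˢ Icc (0 : ℝ) 1)) :
    ContinuousOn (fun x => ∫ s in (0 : ℝ)..1, K (x, s)) T := by
  have hslice : ∀ x ∈ T, ContinuousOn (fun s => K (x, s)) (uIcc (0 : ℝ) 1) := fun x hx =>
    hK.comp (by fun_prop) fun s hs => ⟨hx, by simpa using hs⟩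
  intro x hx
  refine Metric.continuousWithinAt_iff'.2 fun ε hε => ?_
  obtain ⟨v, hv, hvK⟩ := isCompact_Icc.mem_uniformity_of_prod (f := fun x s => K (x, s)) hK hx
    (dist_mem_uniformity (half_pos hε))
  filter_upwards [hv, self_mem_nhdsWithin] with y hy hyT
  rw [dist_eq_norm, ← intervalIntegral.integral_sub (hslice y hyT).intervalIntegrable
    (hslice x hx).intervalIntegrable]
  have := intervalIntegral.norm_integral_le_of_norm_le_const (a := (0 : ℝ)) (b := 1)
    (f := fun s => K (y, s) - K (x, s)) (C := ε / 2) fun s hs => by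
      rw [uIoc_of_le zero_le_one] at hs
      have := hvK y hy s (Ioc_subset_Icc_self hs)
      rw [mem_ofPred_eq, dist_eq_norm] at this
      exact this.le
  simp only [sub_zero, abs_one, mul_one] at this
  linarith

variable {E F : Type u} [NormedAddCommGroup E] [NormedSpace ℝ E]
  [NormedAddCommGroup F] [NormedSpace ℝ F]

theorem hasFDerivWithinAt_parametric_integral_Icc {S U : Set E} (hS : Convex ℝ S) (hU : IsOpen U)
    [CompleteSpace F] {K : E × ℝ → F} {K' : E × ℝ → E →L[ℝ] F}
    (hK : ContinuousOn K ((S ∩ U) ×ˢ Icc (0 : ℝ) 1))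
    (hK' : ContinuousOn K' ((S ∩ U) ×ˢ Icc (0 : ℝ) 1))
    (hderiv : ∀ x ∈ S ∩ U, ∀ s ∈ Icc (0 : ℝ) 1,
      HasFDerivWithinAt (fun y => K (y, s)) (K' (x, s)) (S ∩ U) x)
    {x : E} (hx : x ∈ S ∩ U) :
    HasFDerivWithinAt (fun y => ∫ s in (0 : ℝ)..1, K (y, s)) (∫ s in (0 : ℝ)..1, K' (x, s))
      (S ∩ U) x := by
  have hslice : ∀ y ∈ S ∩ U, ContinuousOn (fun s => K (y, s)) (uIcc (0 : ℝ) 1) := fun y hy =>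
    hK.comp (by fun_prop) fun s hs => ⟨hy, by simpa using hs⟩
  have hslice' : ContinuousOn (fun s => K' (x, s)) (uIcc (0 : ℝ) 1) :=
    hK'.comp (by fun_prop) fun s hs => ⟨hx, by simpa using hs⟩
  rw [hasFDerivWithinAt_iff_isLittleO, Asymptotics.isLittleO_iff]
  intro ε hε
  obtain ⟨v, hv, hvK⟩ := isCompact_Icc.mem_uniformity_of_prod (f := fun x s => K' (x, s)) hK' hx
    (dist_mem_uniformity hε)
  obtain ⟨r, hrpos, hball⟩ := Metric.mem_nhdsWithin_iff.1 hv
  obtain ⟨r', hr'pos, hball'⟩ := Metric.isOpen_iff.1 hU x hx.2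
  wlog hle : r ≤ r' generalizing r
  · exact this r' hr'pos
      ((inter_subset_inter_left _ (ball_subset_ball (not_le.1 hle).le)).trans hball) le_rfl
  have hrU : ball x r ⊆ U := (ball_subset_ball hle).trans hball'
  have hrv : S ∩ ball x r ⊆ v := fun y hy => hball ⟨hy.2, hy.1, hrU hy.2⟩
  have hconv : Convex ℝ (S ∩ ball x r) := hS.inter (convex_ball x r)
  have hsubT : S ∩ ball x r ⊆ S ∩ U := fun y hy => ⟨hy.1, hrU hy.2⟩
  have hxr : x ∈ S ∩ ball x r := ⟨hx.1, mem_ball_self hrpos⟩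
  filter_upwards [self_mem_nhdsWithin, mem_nhdsWithin_of_mem_nhds (ball_mem_nhds x hrpos)]
    with y hyT hyr
  have hyS : y ∈ S ∩ ball x r := ⟨hyT.1, hyr⟩
  have key : ∀ s ∈ Icc (0 : ℝ) 1, ‖K (y, s) - K (x, s) - K' (x, s) (y - x)‖ ≤ ε * ‖y - x‖ := by
    intro s hs
    refine hconv.norm_image_sub_le_of_norm_hasFDerivWithin_le' (f := fun y => K (y, s))
      (f' := fun y => K' (y, s)) (fun z hz => (hderiv z (hsubT hz) s hs).mono hsubT) ?_ hxr hyS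
    intro z hz
    have := hvK z (hrv hz) s hs
    rw [mem_ofPred_eq, dist_eq_norm] at this
    exact this.le
  have hint : (∫ s in (0 : ℝ)..1, K (y, s)) - (∫ s in (0 : ℝ)..1, K (x, s))
      - (∫ s in (0 : ℝ)..1, K' (x, s)) (y - x)
      = ∫ s in (0 : ℝ)..1, (K (y, s) - K (x, s) - K' (x, s) (y - x)) := by
    rw [ContinuousLinearMap.intervalIntegral_apply hslice'.intervalIntegrable,
      intervalIntegral.integral_sub, intervalIntegral.integral_sub]
    · exact (hslice y hyT).intervalIntegrable
    · exact (hslice x hx).intervalIntegrable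
    · exact ((hslice y hyT).sub (hslice x hx)).intervalIntegrable
    · exact (hslice'.clm_apply continuousOn_const).intervalIntegrable
  rw [hint]
  have := intervalIntegral.norm_integral_le_of_norm_le_const (a := (0 : ℝ)) (b := 1)
    (f := fun s => K (y, s) - K (x, s) - K' (x, s) (y - x)) (C := ε * ‖y - x‖) fun s hs => by
      rw [uIoc_of_le zero_le_one] at hs
      exact key s (Ioc_subset_Icc_self hs)
  simpa using this

theorem contDiffOn_parametric_integral_Icc_nat {S U : Set E} (hS : Convex ℝ S)
    (hSi : (interior S).Nonempty) (hU : IsOpen U) (m : ℕ) :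
    ∀ {F : Type u} [NormedAddCommGroup F] [NormedSpace ℝ F] [CompleteSpace F] {K : E × ℝ → F},
      ContDiffOn ℝ m K ((S ∩ U) ×ˢ Icc (0 : ℝ) 1) →
      ContDiffOn ℝ m (fun x => ∫ s in (0 : ℝ)..1, K (x, s)) (S ∩ U) := by
  have huT : UniqueDiffOn ℝ (S ∩ U) := (uniqueDiffOn_convex hS hSi).inter hU
  have hu : UniqueDiffOn ℝ ((S ∩ U) ×ˢ Icc (0 : ℝ) 1) := huT.prod (uniqueDiffOn_Icc zero_lt_one)
  induction m with
  | zero =>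
    intro F _ _ _ K hK
    simp only [Nat.cast_zero, contDiffOn_zero] at hK ⊢
    exact continuousOn_parametric_integral_Icc hK
  | succ m ih =>
    intro F _ _ _ K hK
    have hK' := hK
    rw [Nat.cast_succ, contDiffOn_succ_iff_fderivWithin hu] at hK'
    obtain ⟨hdiff, -, hfd⟩ := hK'
    let K' : E × ℝ → E →L[ℝ] F := fun p =>
      (fderivWithin ℝ K ((S ∩ U) ×ˢ Icc (0 : ℝ) 1) p).comp (ContinuousLinearMap.inl ℝ E ℝ)
    have hK'c : ContDiffOn ℝ m K' ((S ∩ U) ×ˢ Icc (0 : ℝ) 1) := hfd.clm_comp contDiffOn_const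
    rw [Nat.cast_succ, contDiffOn_succ_iff_hasFDerivWithinAt_of_uniqueDiffOn huT]
    refine ⟨fun h => by simp at h, _, ih hK'c, fun x hx =>
      hasFDerivWithinAt_parametric_integral_Icc hS hU hK.continuousOn hK'c.continuousOn ?_ hx⟩
    intro x hx s hs
    have h1 := (hdiff (x, s) ⟨hx, hs⟩).hasFDerivWithinAt
    have hmaps : MapsTo (fun y => (y, s)) (S ∩ U) ((S ∩ U) ×ˢ Icc (0 : ℝ) 1) :=
      fun y hy => ⟨hy, hs⟩
    exact h1.comp x (hasFDerivAt_prodMk_left x s).hasFDerivWithinAt hmaps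

theorem contDiffOn_parametric_integral_Icc [CompleteSpace F] {S U : Set E} (hS : Convex ℝ S)
    (hSi : (interior S).Nonempty) (hU : IsOpen U) {K : E × ℝ → F}
    (hK : ContDiffOn ℝ (⊤ : ℕ∞) K ((S ∩ U) ×ˢ Icc (0 : ℝ) 1)) :
    ContDiffOn ℝ (⊤ : ℕ∞) (fun x => ∫ s in (0 : ℝ)..1, K (x, s)) (S ∩ U) :=
  contDiffOn_infty.2 fun m =>
    contDiffOn_parametric_integral_Icc_nat hS hSi hU m (contDiffOn_infty.1 hK m)

end ParametricIntegral

/-- Hadamard's lemma on a convex set: a smooth function that vanishes at the points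
`x - ρ x • N x` is divisible by `ρ`. -/
theorem exists_contDiffOn_eq_mul {E : Type} [NormedAddCommGroup E] [NormedSpace ℝ E]
    {S U : Set E} (hS : Convex ℝ S) (hSi : (interior S).Nonempty) (hU : IsOpen U) {f ρ : E → ℝ} {N : E → E}
    (hf : ContDiffOn ℝ (⊤ : ℕ∞) f S) (hρ : ContDiffOn ℝ (⊤ : ℕ∞) ρ (S ∩ U))
    (hN : ContDiffOn ℝ (⊤ : ℕ∞) N (S ∩ U))
    (hmem : ∀ x ∈ S ∩ U, x - ρ x • N x ∈ S) (hzero : ∀ x ∈ S ∩ U, f (x - ρ x • N x) = 0) :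
    ∃ w : E → ℝ, ContDiffOn ℝ (⊤ : ℕ∞) w (S ∩ U) ∧ ∀ x ∈ S ∩ U, f x = ρ x * w x := by
  have huS : UniqueDiffOn ℝ S := uniqueDiffOn_convex hS hSi
  have hpath : ∀ x ∈ S ∩ U, ∀ s ∈ Icc (0 : ℝ) 1, x - (s * ρ x) • N x ∈ S := by
    intro x hx s hs
    have := hS hx.1 (hmem x hx) (sub_nonneg.2 hs.2) hs.1 (by ring)
    convert this using 1
    module
  obtain ⟨hfd, hf'⟩ := (contDiffOn_infty_iff_fderivWithin huS).1 hf
  refine ⟨fun x => ∫ s in (0 : ℝ)..1,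
    fderivWithin ℝ f S (x - (s * ρ x) • N x) (N x), ?_, ?_⟩
  · refine contDiffOn_parametric_integral_Icc hS hSi hU
      (K := fun p => fderivWithin ℝ f S (p.1 - (p.2 * ρ p.1) • N p.1) (N p.1)) ?_
    have h1 : ContDiffOn ℝ (⊤ : ℕ∞) (fun p : E × ℝ => ρ p.1) ((S ∩ U) ×ˢ Icc (0 : ℝ) 1) :=
      hρ.comp contDiffOn_fst fun p hp => hp.1
    have h2 : ContDiffOn ℝ (⊤ : ℕ∞) (fun p : E × ℝ => N p.1) ((S ∩ U) ×ˢ Icc (0 : ℝ) 1) :=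
      hN.comp contDiffOn_fst fun p hp => hp.1
    have h3 : ContDiffOn ℝ (⊤ : ℕ∞) (fun p : E × ℝ => p.1 - (p.2 * ρ p.1) • N p.1)
        ((S ∩ U) ×ˢ Icc (0 : ℝ) 1) :=
      contDiffOn_fst.sub ((contDiffOn_snd.mul h1).smul h2)
    exact (hf'.comp h3 fun p hp => hpath p.1 hp.1 p.2 hp.2).clm_apply h2
  · intro x hx
    have hγ : ∀ s ∈ Icc (0 : ℝ) 1, HasDerivWithinAt (fun s => f (x - (s * ρ x) • N x))
        (fderivWithin ℝ f S (x - (s * ρ x) • N x) (-(ρ x • N x))) (Icc 0 1) s := by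
      intro s hs
      have hd : HasDerivWithinAt (fun s : ℝ => x - (s * ρ x) • N x) (-(ρ x • N x)) (Icc 0 1) s := by
        have := (((hasDerivWithinAt_id s (Icc 0 1)).mul_const (ρ x)).smul_const (N x)).const_sub x
        simpa using this
      exact ((hfd _ (hpath x hx s hs)).hasFDerivWithinAt).comp_hasDerivWithinAt s hd
        fun t ht => hpath x hx t ht
    have hcont : ContinuousOn (fun s : ℝ => fderivWithin ℝ f S (x - (s * ρ x) • N x))
        (Icc (0 : ℝ) 1) :=
      hf'.continuousOn.comp (by fun_prop) fun s hs => hpath x hx s hs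
    have hint := intervalIntegral.integral_eq_sub_of_hasDeriv_right_of_le (zero_le_one' ℝ)
      (fun s hs => (hγ s hs).continuousWithinAt)
      (fun s hs => ((hγ s (Ioo_subset_Icc_self hs)).hasDerivAt
        (Icc_mem_nhds hs.1 hs.2)).hasDerivWithinAt)
      (ContinuousOn.intervalIntegrable (by
        rw [uIcc_of_le zero_le_one]; exact hcont.clm_apply continuousOn_const))
    simp only [one_mul, zero_mul, zero_smul, sub_zero, hzero x hx, map_neg, map_smul,
      smul_eq_mul, intervalIntegral.integral_neg, intervalIntegral.integral_const_mul] at hint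
    linarith

section Laplacian

variable {n : ℕ} {f g : EuclideanSpace ℝ (Fin n) → ℝ} {x : EuclideanSpace ℝ (Fin n)}

theorem lap_congr (h : f =ᶠ[nhds x] g) : lap f x = lap g x := by
  refine Finset.sum_congr rfl fun i _ => ?_
  have h' : (fun y => fderiv ℝ f y (EuclideanSpace.single i 1)) =ᶠ[nhds x]
      fun y => fderiv ℝ g y (EuclideanSpace.single i 1) := by
    filter_upwards [h.fderiv (𝕜 := ℝ)] with y hy
    rw [hy]
  rw [h'.fderiv_eq]

theorem ContDiffAt.eventually_differentiableAt_of_two (hf : ContDiffAt ℝ 2 f x) :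
    ∀ᶠ y in nhds x, DifferentiableAt ℝ f y :=
  (hf.eventually (by simp)).mono fun _ hy => hy.differentiableAt (by simp)

theorem ContDiffAt.differentiableAt_fderiv_apply (hf : ContDiffAt ℝ 2 f x)
    (e : EuclideanSpace ℝ (Fin n)) : DifferentiableAt ℝ (fun y => fderiv ℝ f y e) x :=
  ((hf.fderiv_right (m := 1) (by norm_num)).differentiableAt (by simp)).clm_apply
    (differentiableAt_const e)

theorem inner_gradient_gradient (f g : EuclideanSpace ℝ (Fin n) → ℝ)
    (x : EuclideanSpace ℝ (Fin n)) :
    ⟪gradient f x, gradient g x⟫ = ∑ i : Fin n, fderiv ℝ f x (EuclideanSpace.single i 1) *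
      fderiv ℝ g x (EuclideanSpace.single i 1) := by
  rw [← (EuclideanSpace.basisFun (Fin n) ℝ).sum_inner_mul_inner]
  refine Finset.sum_congr rfl fun i _ => ?_
  rw [inner_gradient_left, inner_gradient_right]
  simp

theorem lap_add (hf : ContDiffAt ℝ 2 f x) (hg : ContDiffAt ℝ 2 g x) :
    lap (fun y => f y + g y) x = lap f x + lap g x := by
  rw [lap, lap, lap, ← Finset.sum_add_distrib]
  refine Finset.sum_congr rfl fun i _ => ?_
  have h : (fun y => fderiv ℝ (fun y => f y + g y) y (EuclideanSpace.single i 1)) =ᶠ[nhds x]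
      fun y => fderiv ℝ f y (EuclideanSpace.single i 1) +
        fderiv ℝ g y (EuclideanSpace.single i 1) := by
    filter_upwards [hf.eventually_differentiableAt_of_two, hg.eventually_differentiableAt_of_two]
      with y hfy hgy
    rw [fderiv_fun_add hfy hgy]
    rfl
  rw [h.fderiv_eq, fderiv_fun_add (hf.differentiableAt_fderiv_apply _)
    (hg.differentiableAt_fderiv_apply _)]
  rfl

theorem lap_mul (hf : ContDiffAt ℝ 2 f x) (hg : ContDiffAt ℝ 2 g x) :
    lap (fun y => f y * g y) x =
      f x * lap g x + g x * lap f x + 2 * ⟪gradient f x, gradient g x⟫ := by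
  rw [inner_gradient_gradient, lap, lap, lap, Finset.mul_sum, Finset.mul_sum, Finset.mul_sum,
    ← Finset.sum_add_distrib, ← Finset.sum_add_distrib]
  refine Finset.sum_congr rfl fun i _ => ?_
  set e : EuclideanSpace ℝ (Fin n) := EuclideanSpace.single i 1
  have h : (fun y => fderiv ℝ (fun y => f y * g y) y e) =ᶠ[nhds x]
      fun y => f y * fderiv ℝ g y e + g y * fderiv ℝ f y e := by
    filter_upwards [hf.eventually_differentiableAt_of_two, hg.eventually_differentiableAt_of_two]
      with y hfy hgy
    rw [fderiv_fun_mul hfy hgy]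
    rfl
  have hf1 := hf.differentiableAt (by simp)
  have hg1 := hg.differentiableAt (by simp)
  have hf2 := hf.differentiableAt_fderiv_apply e
  have hg2 := hg.differentiableAt_fderiv_apply e
  rw [h.fderiv_eq, fderiv_fun_add (hf1.fun_mul hg2) (hg1.fun_mul hf2), fderiv_fun_mul hf1 hg2,
    fderiv_fun_mul hg1 hf2]
  simp only [add_apply, smul_apply, smul_eq_mul]
  ring

theorem lap_const (c : ℝ) : lap (fun _ => c) x = 0 := by
  simp [lap]

theorem lap_const_mul (c : ℝ) (hf : ContDiffAt ℝ 2 f x) :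
    lap (fun y => c * f y) x = c * lap f x := by
  rw [lap_mul contDiffAt_const hf, lap_const, inner_gradient_gradient]
  simp

theorem IsLocalMin.deriv_deriv_nonneg {φ : ℝ → ℝ} {a : ℝ} (h : IsLocalMin φ a)
    (hc : ContinuousAt φ a) : 0 ≤ deriv (deriv φ) a := by
  by_contra! hneg
  have hmax := isLocalMax_of_deriv_deriv_neg hneg h.deriv_eq_zero hc
  have heq : φ =ᶠ[nhds a] fun _ => φ a := by
    filter_upwards [h, hmax] with y h1 h2 using le_antisymm h2 h1
  have : deriv (deriv φ) a = 0 := by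
    rw [heq.deriv.deriv_eq]
    simp
  linarith

theorem IsLocalMin.lap_nonneg (h : IsLocalMin f x) (hf : ContDiffAt ℝ 2 f x) : 0 ≤ lap f x := by
  refine Finset.sum_nonneg fun i _ => ?_
  set e : EuclideanSpace ℝ (Fin n) := EuclideanSpace.single i 1
  have hline : ∀ s : ℝ, HasDerivAt (fun s : ℝ => x + s • e) e s := fun s => by
    simpa using ((hasDerivAt_id s).smul_const e).const_add x
  have hcont : Filter.Tendsto (fun s : ℝ => x + s • e) (nhds 0) (nhds x) := by
    simpa using (hline 0).continuousAt.tendsto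
  have hx0 : x + (0 : ℝ) • e = x := by simp
  have hderiv : deriv (fun s : ℝ => f (x + s • e)) =ᶠ[nhds 0]
      fun s => fderiv ℝ f (x + s • e) e := by
    filter_upwards [hcont.eventually hf.eventually_differentiableAt_of_two] with s hs
    exact (hs.hasFDerivAt.comp_hasDerivAt s (hline s)).deriv
  have hderiv2 : deriv (deriv fun s : ℝ => f (x + s • e)) 0
      = fderiv ℝ (fun y => fderiv ℝ f y e) x e := by
    rw [hderiv.deriv_eq]
    have h2 := (hf.differentiableAt_fderiv_apply e).hasFDerivAt
    rw [← hx0] at h2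
    have := (h2.comp_hasDerivAt (0 : ℝ) (hline 0)).deriv
    rw [hx0] at this
    exact this
  rw [← hderiv2]
  refine IsLocalMin.deriv_deriv_nonneg ?_ ?_
  · have := hcont.eventually h
    filter_upwards [this] with s hs
    simpa using hs
  · refine ContinuousAt.comp ?_ (hline 0).continuousAt
    rw [hx0]
    exact hf.continuousAt

/-- On compact subsets of a set of unique differentiability, the Laplacian of a smooth function is
bounded at the interior points. -/
theorem exists_abs_lap_le {T K : Set (EuclideanSpace ℝ (Fin n))} (hT : UniqueDiffOn ℝ T)
    (hK : IsCompact K) (hKT : K ⊆ T) (hf : ContDiffOn ℝ (⊤ : ℕ∞) f T) :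
    ∃ A, ∀ y ∈ K, T ∈ nhds y → |lap f y| ≤ A := by
  obtain ⟨-, hf1⟩ := (contDiffOn_infty_iff_fderivWithin hT).1 hf
  have hf1' : ∀ e, ContDiffOn ℝ (⊤ : ℕ∞) (fun y => fderivWithin ℝ f T y e) T :=
    fun e => hf1.clm_apply contDiffOn_const
  have hcont : ContinuousOn (fun y => ∑ i : Fin n,
      fderivWithin ℝ (fun y => fderivWithin ℝ f T y (EuclideanSpace.single i 1)) T y
        (EuclideanSpace.single i 1)) K := by
    refine ContinuousOn.mono ?_ hKT
    refine continuousOn_finsetSum _ fun i _ => ?_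
    exact ((contDiffOn_infty_iff_fderivWithin hT).1 (hf1' _)).2.continuousOn.clm_apply
      continuousOn_const
  obtain ⟨A, hA⟩ := hK.exists_bound_of_continuousOn hcont
  refine ⟨A, fun y hy hTy => ?_⟩
  convert hA y hy using 1
  rw [Real.norm_eq_abs, lap]
  congr 1
  refine Finset.sum_congr rfl fun i _ => ?_
  rw [fderivWithin_of_mem_nhds hTy]
  congr 1
  refine Filter.EventuallyEq.fderiv_eq ?_
  filter_upwards [eventually_mem_nhds_iff.2 hTy] with z hz
  rw [fderivWithin_of_mem_nhds hz]

end Laplacian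

section Distance

variable {n : ℕ} {A : Set (EuclideanSpace ℝ (Fin n))} {x : EuclideanSpace ℝ (Fin n)}

/-- Where the distance to a closed set is differentiable, the nearest point is
`x - d x • ∇d x`. -/
theorem sub_infDist_smul_gradient_eq (hd : DifferentiableAt ℝ (fun y => infDist y A) x)
    {y : EuclideanSpace ℝ (Fin n)} (hy : y ∈ A) (hxy : infDist x A = dist x y) :
    x - infDist x A • gradient (fun y => infDist y A) x = y := by
  set d := fun y => infDist y A
  set N := gradient d x
  have hD : 0 ≤ d x := infDist_nonneg
  have hnorm : ‖y - x‖ = d x := by rw [← dist_eq_norm', ← hxy]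
  have hN : ‖N‖ ≤ 1 := by
    have h := norm_fderiv_le_of_lipschitz ℝ (lipschitz_infDist_pt A) (x₀ := x)
    rw [← toDual_gradient, LinearIsometryEquiv.norm_map] at h
    simpa using h
  have hpath : ∀ s ∈ Icc (0 : ℝ) 1, d (x + s • (y - x)) = d x - s * d x := by
    intro s hs
    refine le_antisymm ?_ ?_
    · refine (infDist_le_dist_of_mem hy).trans_eq ?_
      rw [dist_eq_norm', show y - (x + s • (y - x)) = (1 - s) • (y - x) by module, norm_smul, hnorm,
        Real.norm_of_nonneg (sub_nonneg.2 hs.2)]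
      ring
    · have := infDist_le_infDist_add_dist (s := A) (x := x) (y := x + s • (y - x))
      rw [dist_eq_norm', add_sub_cancel_left, norm_smul, hnorm, Real.norm_of_nonneg hs.1] at this
      change d x ≤ d _ + _ at this
      linarith
  have hinner : ⟪N, y - x⟫ = -d x := by
    have hline : HasDerivWithinAt (fun s : ℝ => x + s • (y - x)) (y - x) (Icc 0 1) 0 := by
      simpa using ((hasDerivWithinAt_id (0 : ℝ) (Icc 0 1)).smul_const (y - x)).const_add x
    have hd' : HasFDerivAt d (fderiv ℝ d x) (x + (0 : ℝ) • (y - x)) := by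
      simpa using hd.hasFDerivAt
    have h1 := hd'.comp_hasDerivWithinAt (0 : ℝ) hline
    have h2 : HasDerivWithinAt (fun s : ℝ => d x - s * d x) (-d x) (Icc 0 1) 0 := by
      simpa using ((hasDerivWithinAt_id (0 : ℝ) (Icc 0 1)).mul_const (d x)).const_sub (d x)
    have h3 := h2.congr_of_mem (f₁ := d ∘ fun s : ℝ => x + s • (y - x)) hpath (by simp)
    rw [inner_gradient_left]
    exact (uniqueDiffOn_Icc zero_lt_one 0 (by simp)).eq_deriv _ h1 h3
  have hsq : ‖d x • N + (y - x)‖ ^ 2 ≤ 0 := by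
    rw [norm_add_sq_real, norm_smul, inner_smul_left, hinner, hnorm, Real.norm_of_nonneg hD]
    simp only [conj_trivial]
    nlinarith [mul_le_mul_of_nonneg_left (pow_le_one₀ (n := 2) (norm_nonneg N) hN) (sq_nonneg (d x))]
  have hzero : d x • N + (y - x) = 0 := by
    have := sq_nonneg ‖d x • N + (y - x)‖
    have h0 : ‖d x • N + (y - x)‖ ^ 2 = 0 := le_antisymm hsq this
    simpa using h0
  change x - d x • N = y
  rw [eq_comm, ← sub_eq_zero, ← hzero]
  abel

theorem sub_infDist_smul_gradient_mem (hA : IsClosed A) (hne : A.Nonempty)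
    (hd : DifferentiableAt ℝ (fun y => infDist y A) x) :
    x - infDist x A • gradient (fun y => infDist y A) x ∈ A := by
  obtain ⟨y, hy, hxy⟩ := hA.exists_infDist_eq_dist hne x
  rwa [sub_infDist_smul_gradient_eq hd hy hxy]

theorem norm_gradient_infDist (hA : IsClosed A) (hne : A.Nonempty) (hx : x ∉ A)
    (hd : DifferentiableAt ℝ (fun y => infDist y A) x) :
    ‖gradient (fun y => infDist y A) x‖ = 1 := by
  obtain ⟨y, hy, hxy⟩ := hA.exists_infDist_eq_dist hne x
  have h := sub_infDist_smul_gradient_eq hd hy hxy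
  have hpos : 0 < infDist x A := (hA.notMem_iff_infDist_pos hne).1 hx
  have h' : infDist x A • gradient (fun y => infDist y A) x = x - y := by
    rw [← h]; abel
  have := congrArg norm h'
  rw [norm_smul, Real.norm_of_nonneg hpos.le, ← dist_eq_norm, ← hxy] at this
  exact mul_left_cancel₀ hpos.ne' (this.trans (mul_one _).symm)

end Distance

section Hopf

variable {n : ℕ} {Ω : Set (EuclideanSpace ℝ (Fin n))}

/-- A quantitative Hopf lemma: a positive supersolution of `Δf = Mf` grows at least linearly in
the distance to the boundary. -/
theorem exists_mul_infDist_le_s10 (hΩ : IsOpen Ω) (hbdd : Bornology.IsBounded Ω)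
    (hne : (frontier Ω).Nonempty) {r₁ A M : ℝ} (hr₁ : 0 < r₁) (hM : 0 ≤ M)
    (hd : ∀ x ∈ Ω, infDist x (frontier Ω) < r₁ →
      ContDiffAt ℝ 2 (fun y => infDist y (frontier Ω)) x)
    (hA : ∀ x ∈ Ω, infDist x (frontier Ω) < r₁ →
      |lap (fun y => infDist y (frontier Ω)) x| ≤ A)
    {f : EuclideanSpace ℝ (Fin n) → ℝ} (hf : ContinuousOn f (closure Ω))
    (hf2 : ∀ x ∈ Ω, ContDiffAt ℝ 2 f x) (hpos : ∀ x ∈ Ω, 0 < f x)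
    (hzero : ∀ x ∈ frontier Ω, f x = 0) (hsuper : ∀ x ∈ Ω, lap f x ≤ M * f x) :
    ∃ ε > 0, ∃ r > 0, ∀ x ∈ Ω, infDist x (frontier Ω) < r →
      ε * infDist x (frontier Ω) ≤ f x := by
  wlog hA0 : 0 ≤ A generalizing A
  · exact this (A := |A|) (fun x hx h => (hA x hx h).trans (le_abs_self A)) (abs_nonneg A)
  set d := fun y => infDist y (frontier Ω)
  have hdc : Continuous d := continuous_infDist_pt _
  have hd0 : ∀ x, 0 ≤ d x := fun x => infDist_nonneg
  have hfr : ∀ x ∈ frontier Ω, d x = 0 := fun x hx => infDist_zero_of_mem hx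
  have hΩfr : ∀ x ∈ Ω, x ∉ frontier Ω := fun x hx h => by
    rw [hΩ.frontier_eq] at h
    exact h.2 hx
  have hΩcl : ∀ x ∈ closure Ω, x ∉ frontier Ω → x ∈ Ω := fun x hx h => by
    rw [hΩ.frontier_eq] at h
    by_contra hxΩ
    exact h ⟨hx, hxΩ⟩
  set K := A + M + 1
  have hKpos : 0 < K := by positivity
  obtain ⟨r, hr, hrr₁, hrK⟩ : ∃ r > 0, r < r₁ ∧ r * (4 * K) ≤ 1 := by
    refine ⟨min (r₁ / 2) (1 / (4 * K)), by positivity, ?_, ?_⟩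
    · exact (min_le_left _ _).trans_lt (half_lt_self hr₁)
    · exact (le_div_iff₀ (by positivity)).1 (min_le_right _ _)
  have hcomp : IsCompact (closure Ω) := hbdd.isCompact_closure
  have hcompr : IsCompact (closure Ω ∩ {x | d x ≤ r}) :=
    hcomp.inter_right (isClosed_le hdc continuous_const)
  obtain ⟨m, hm, hfm⟩ : ∃ m, 0 < m ∧ ∀ x ∈ closure Ω ∩ {x | d x = r}, m ≤ f x := by
    refine (hcomp.inter_right (isClosed_eq hdc continuous_const)).exists_forall_le'
      (hf.mono inter_subset_left) fun x hx => hpos x (hΩcl x hx.1 fun h => ?_)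
    have h1 : d x = r := hx.2
    rw [hfr x h] at h1
    exact hr.ne h1
  have hQ : 0 < r + K * r * r := by positivity
  set ε := m / (r + K * r * r) with hε
  have hεpos : 0 < ε := div_pos hm hQ
  set h : EuclideanSpace ℝ (Fin n) → ℝ := fun x => d x + K * (d x * d x) with hh
  have hhc : Continuous h := by fun_prop
  have hlap : ∀ x ∈ Ω, d x < r → ContDiffAt ℝ 2 h x ∧ M * h x < lap h x := by
    intro x hx hxr
    have h2 := hd x hx (hxr.trans hrr₁)
    have hmul : ContDiffAt ℝ 2 (fun y => d y * d y) x := h2.mul h2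
    refine ⟨h2.add (contDiffAt_const.mul hmul), ?_⟩
    have hnorm : ⟪gradient d x, gradient d x⟫ = 1 := by
      rw [real_inner_self_eq_norm_sq, norm_gradient_infDist isClosed_frontier hne (hΩfr x hx)
        (h2.differentiableAt (by simp)), one_pow]
    rw [hh, lap_add h2 (contDiffAt_const.mul hmul), lap_const_mul K hmul, lap_mul h2 h2, hnorm]
    have hAx := abs_le.1 (hA x hx (hxr.trans hrr₁))
    set L := lap d x
    have hdx := hd0 x
    have hdK : d x * (4 * K) ≤ 1 := (mul_le_mul_of_nonneg_right hxr.le (by positivity)).trans hrK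
    have e1 : -(A * (d x * (4 * K))) ≤ L * (d x * (4 * K)) := by
      nlinarith [mul_nonneg hdx (by positivity : (0 : ℝ) ≤ 4 * K), hAx.1]
    have e2 : A * (d x * (4 * K)) ≤ A := by nlinarith
    have e3 : M * (d x * (4 * K)) ≤ M := by nlinarith
    have e4 : M * d x ≤ 1 / 4 := by nlinarith [mul_nonneg hdx hA0, mul_nonneg hdx hM]
    nlinarith
  have hmin : ∀ x ∈ closure Ω ∩ {x | d x ≤ r}, 0 ≤ f x - ε * h x := by
    have hcont : ContinuousOn (fun x => f x - ε * h x) (closure Ω ∩ {x | d x ≤ r}) :=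
      (hf.mono inter_subset_left).sub (by fun_prop)
    obtain ⟨y, hy⟩ := hne
    have hnonempty : (closure Ω ∩ {x | d x ≤ r}).Nonempty :=
      ⟨y, frontier_subset_closure hy, (hfr y hy).trans_le hr.le⟩
    obtain ⟨z, hz, hzmin⟩ := hcompr.exists_isMinOn hnonempty hcont
    suffices 0 ≤ f z - ε * h z from fun x hx => this.trans (hzmin hx)
    by_contra! hneg
    have hzΩ : z ∈ Ω := hΩcl z hz.1 fun hzfr => by
      simp only [hh, hzero z hzfr, hfr z hzfr] at hneg
      simp at hneg
    have hzr : d z < r := lt_of_le_of_ne hz.2 fun heq => by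
      have h1 := hfm z ⟨hz.1, heq⟩
      have h2 : ε * h z = m := by
        simp only [hh, heq, hε]
        field_simp
      linarith
    have hnhds : closure Ω ∩ {x | d x ≤ r} ∈ nhds z := by
      filter_upwards [hΩ.mem_nhds hzΩ, (isOpen_lt hdc continuous_const).mem_nhds hzr] with x h1 h2
      exact ⟨subset_closure h1, le_of_lt h2⟩
    obtain ⟨hh2, hlt⟩ := hlap z hzΩ hzr
    have hcd : ContDiffAt ℝ 2 (fun x => -ε * h x) z := contDiffAt_const.mul hh2
    have hloc : IsLocalMin (fun x => f x + -ε * h x) z := by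
      filter_upwards [hnhds] with x hx
      have h1 : f z - ε * h z ≤ f x - ε * h x := hzmin hx
      linarith
    have hnn := hloc.lap_nonneg ((hf2 z hzΩ).add hcd)
    rw [lap_add (hf2 z hzΩ) hcd, lap_const_mul _ hh2] at hnn
    have h1 := hsuper z hzΩ
    have h2 := mul_lt_mul_of_pos_left hlt hεpos
    nlinarith
  refine ⟨ε, hεpos, r, hr, fun x hx hxr => ?_⟩
  have h1 := hmin x ⟨subset_closure hx, le_of_lt hxr⟩
  have h2 : 0 ≤ ε * (K * (d x * d x)) :=
    mul_nonneg hεpos.le (mul_nonneg hKpos.le (mul_self_nonneg _))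
  simp only [hh] at h1
  change ε * d x ≤ f x
  linarith

end Hopf

section Quotient

theorem two_le_infty : (2 : WithTop ℕ∞) ≤ ((⊤ : ℕ∞) : WithTop ℕ∞) :=
  WithTop.coe_le_coe.2 (le_top : (2 : ℕ∞) ≤ ⊤)

variable {n : ℕ} {Ω : Set (EuclideanSpace ℝ (Fin n))}

/-- A vector field pointing along the gradient of the distance to the boundary, smooth up to the
boundary. -/
theorem exists_contDiffOn_sub_infDist_smul_mem (hΩ : IsOpen Ω) (hne : (frontier Ω).Nonempty)
    {r₀ : ℝ}
    (hT : UniqueDiffOn ℝ (closure Ω ∩ {x | infDist x (frontier Ω) < r₀}))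
    (hd : ContDiffOn ℝ (⊤ : ℕ∞) (fun x => infDist x (frontier Ω))
      (closure Ω ∩ {x | infDist x (frontier Ω) < r₀})) :
    ∃ N : EuclideanSpace ℝ (Fin n) → EuclideanSpace ℝ (Fin n),
      ContDiffOn ℝ (⊤ : ℕ∞) N (closure Ω ∩ {x | infDist x (frontier Ω) < r₀}) ∧
      ∀ x ∈ closure Ω ∩ {x | infDist x (frontier Ω) < r₀},
        x - infDist x (frontier Ω) • N x ∈ frontier Ω := by
  set d := fun y => infDist y (frontier Ω)
  set T := closure Ω ∩ {x | infDist x (frontier Ω) < r₀}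
  refine ⟨gradientWithin d T, ?_, fun x hx => ?_⟩
  · rw [contDiffOn_euclidean]
    intro i
    have h1 : ContDiffOn ℝ (⊤ : ℕ∞) (fun x => fderivWithin ℝ d T x (EuclideanSpace.single i 1)) T :=
      ((contDiffOn_infty_iff_fderivWithin hT).1 hd).2.clm_apply contDiffOn_const
    refine h1.congr fun x _ => ?_
    have h2 := inner_gradientWithin_left (𝕜 := ℝ) (f := d) (s := T) (x := x)
      (y := EuclideanSpace.single i 1)
    rw [EuclideanSpace.inner_single_right] at h2
    simpa only [conj_trivial, one_mul] using h2
  · by_cases hxΩ : x ∈ Ω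
    · have hnhds : T ∈ nhds x := by
        filter_upwards [hΩ.mem_nhds hxΩ,
          (isOpen_lt (continuous_infDist_pt (frontier Ω)) continuous_const).mem_nhds hx.2]
          with y h1 h2 using ⟨subset_closure h1, h2⟩
      have hdiff : DifferentiableAt ℝ d x :=
        (hd.contDiffAt hnhds).differentiableAt (by simp)
      have heq : gradientWithin d T x = gradient d x := by
        rw [gradientWithin, gradient, fderivWithin_of_mem_nhds hnhds]
      rw [heq]
      exact sub_infDist_smul_gradient_mem isClosed_frontier hne hdiff
    · have hxfr : x ∈ frontier Ω := by
        rw [hΩ.frontier_eq]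
        exact ⟨hx.1, hxΩ⟩
      rw [infDist_zero_of_mem hxfr]
      simpa using hxfr

/-- A smooth function vanishing on the boundary is divisible by a positive supersolution
vanishing on the boundary. -/
theorem exists_contDiffOn_eq_div (hΩ : IsOpen Ω) (hΩne : Ω.Nonempty)
    (hbdd : Bornology.IsBounded Ω) (hconv : Convex ℝ Ω) {r₀ : ℝ} (hr₀ : 0 < r₀)
    (hd : ContDiffOn ℝ (⊤ : ℕ∞) (fun x => infDist x (frontier Ω))
      {x ∈ closure Ω | infDist x (frontier Ω) ≤ r₀})
    {φ : EuclideanSpace ℝ (Fin n) → ℝ} (hφ : ContDiffOn ℝ (⊤ : ℕ∞) φ (closure Ω))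
    (hpos : ∀ x ∈ Ω, 0 < φ x) (hzero : ∀ x ∈ frontier Ω, φ x = 0)
    {M : ℝ} (hM : 0 ≤ M) (hsuper : ∀ x ∈ Ω, lap φ x ≤ M * φ x)
    {f : ℝ × EuclideanSpace ℝ (Fin n) → ℝ}
    (hf : ContDiffOn ℝ (⊤ : ℕ∞) f (Ici 0 ×ˢ closure Ω))
    (hfzero : ∀ t ∈ Ici (0 : ℝ), ∀ x ∈ frontier Ω, f (t, x) = 0) :
    ∃ q : ℝ × EuclideanSpace ℝ (Fin n) → ℝ, ContDiffOn ℝ (⊤ : ℕ∞) q (Ici 0 ×ˢ closure Ω) ∧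
      ∀ t ∈ Ici (0 : ℝ), ∀ x ∈ Ω, q (t, x) = f (t, x) / φ x := by
  have hφS : ContDiffOn ℝ (⊤ : ℕ∞) (fun p : ℝ × EuclideanSpace ℝ (Fin n) => φ p.2)
      (Ici 0 ×ˢ closure Ω) := hφ.comp contDiffOn_snd fun p hp => hp.2
  rcases (frontier Ω).eq_empty_or_nonempty with hemp | hne
  · have hcl : closure Ω = Ω := by
      rw [closure_eq_self_union_frontier, hemp, union_empty]
    refine ⟨fun p => f p / φ p.2, hf.div hφS fun p hp => ?_, fun _ _ _ _ => rfl⟩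
    exact (hpos _ (hcl ▸ hp.2)).ne'
  set d := fun y => infDist y (frontier Ω) with hd_def
  have hdc : Continuous d := continuous_infDist_pt _
  have hfrΩ : ∀ x ∈ closure Ω, x ∉ Ω → x ∈ frontier Ω := fun x hx h => by
    rw [hΩ.frontier_eq]
    exact ⟨hx, h⟩
  have hUo : IsOpen {x | d x < r₀} := isOpen_lt hdc continuous_const
  have hcli : (interior (closure Ω)).Nonempty :=
    hΩne.mono (interior_maximal subset_closure hΩ)
  have hT : UniqueDiffOn ℝ (closure Ω ∩ {x | d x < r₀}) :=
    (uniqueDiffOn_convex hconv.closure hcli).inter hUo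
  have hdT : ContDiffOn ℝ (⊤ : ℕ∞) d (closure Ω ∩ {x | d x < r₀}) :=
    hd.mono fun x hx => ⟨hx.1, le_of_lt hx.2⟩
  have hTnhds : ∀ x ∈ Ω, d x < r₀ → closure Ω ∩ {x | d x < r₀} ∈ nhds x := fun x hx hxr => by
    filter_upwards [hΩ.mem_nhds hx, hUo.mem_nhds hxr] with y h1 h2 using ⟨subset_closure h1, h2⟩
  obtain ⟨N, hN, hNmem⟩ := exists_contDiffOn_sub_infDist_smul_mem hΩ hne hT hdT
  obtain ⟨wφ, hwφ, hφeq⟩ := exists_contDiffOn_eq_mul hconv.closure hcli hUo hφ hdT hN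
    (fun x hx => frontier_subset_closure (hNmem x hx)) (fun x hx => hzero _ (hNmem x hx))
  have hSi : (interior (Ici (0 : ℝ) ×ˢ closure Ω)).Nonempty := by
    rw [interior_prod_eq, interior_Ici]
    exact nonempty_Ioi.prod hcli
  have hUo' : IsOpen {p : ℝ × EuclideanSpace ℝ (Fin n) | d p.2 < r₀} :=
    isOpen_lt (hdc.comp continuous_snd) continuous_const
  have hmaps : MapsTo (Prod.snd : ℝ × EuclideanSpace ℝ (Fin n) → _)
      (Ici 0 ×ˢ closure Ω ∩ {p | d p.2 < r₀}) (closure Ω ∩ {x | d x < r₀}) :=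
    fun p hp => ⟨hp.1.2, hp.2⟩
  obtain ⟨wf, hwf, hfeq⟩ := exists_contDiffOn_eq_mul ((convex_Ici (0 : ℝ)).prod hconv.closure) hSi
    hUo' (ρ := fun p => d p.2) (N := fun p => (0, N p.2)) hf (hdT.comp contDiffOn_snd hmaps)
    (contDiffOn_const.prodMk (hN.comp contDiffOn_snd hmaps))
    (fun p hp => ⟨by simpa using hp.1.1, frontier_subset_closure (hNmem _ (hmaps hp))⟩)
    (fun p hp => by
      have := hfzero p.1 hp.1.1 _ (hNmem _ (hmaps hp))
      convert this using 2
      ext1 <;> simp [hd_def])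
  have hcompr : IsCompact (closure Ω ∩ {x | d x ≤ r₀ / 2}) :=
    hbdd.isCompact_closure.inter_right (isClosed_le hdc continuous_const)
  obtain ⟨A, hA⟩ := exists_abs_lap_le hT hcompr
    (fun x hx => ⟨hx.1, lt_of_le_of_lt hx.2 (half_lt_self hr₀)⟩) hdT
  obtain ⟨ε, hε, r, hr, hlow⟩ := exists_mul_infDist_le_s10 hΩ hbdd hne (half_pos hr₀) hM
    (fun x hx hxr => (hdT.contDiffAt (hTnhds x hx (hxr.trans (half_lt_self hr₀)))).of_le
      two_le_infty)
    (fun x hx hxr => hA x ⟨subset_closure hx, le_of_lt hxr⟩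
      (hTnhds x hx (hxr.trans (half_lt_self hr₀))))
    hφ.continuousOn
    (fun x hx => (hφ.contDiffAt (Filter.mem_of_superset (hΩ.mem_nhds hx) subset_closure)).of_le
      two_le_infty) hpos hzero hsuper
  have hdpos : ∀ x ∈ Ω, 0 < d x := fun x hx =>
    (isClosed_frontier.notMem_iff_infDist_pos hne).1 fun h => by
      rw [hΩ.frontier_eq] at h
      exact h.2 hx
  have hwφ0 : ∀ x ∈ closure Ω ∩ {x | d x < r₀}, wφ x ≠ 0 := by
    intro x hx
    by_cases hxΩ : x ∈ Ω
    · intro h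
      have := hpos x hxΩ
      rw [hφeq x hx, h, mul_zero] at this
      exact this.false
    · have hx0 : d x = 0 := infDist_zero_of_mem (hfrΩ x hx.1 hxΩ)
      have hle : nhdsWithin x Ω ≤ nhdsWithin x (closure Ω ∩ {x | d x < r₀}) := by
        rw [nhdsWithin_inter_of_mem' (mem_nhdsWithin_of_mem_nhds (hUo.mem_nhds hx.2))]
        exact nhdsWithin_mono x subset_closure
      have htend := (hwφ.continuousOn x hx).tendsto.mono_left hle
      have := mem_closure_iff_nhdsWithin_neBot.1 hx.1
      refine (hε.trans_le (ge_of_tendsto htend ?_)).ne'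
      have hsmall : ∀ᶠ y in nhds x, d y < min r r₀ :=
        (isOpen_lt hdc continuous_const).mem_nhds (by simpa [hx0] using ⟨hr, hr₀⟩)
      filter_upwards [self_mem_nhdsWithin, mem_nhdsWithin_of_mem_nhds hsmall] with y hyΩ hyr
      have h1 := hlow y hyΩ (hyr.trans_le (min_le_left _ _))
      rw [hφeq y ⟨subset_closure hyΩ, hyr.trans_le (min_le_right _ _)⟩, mul_comm] at h1
      exact le_of_mul_le_mul_left h1 (hdpos y hyΩ)
  classical
  refine ⟨fun p => if p.2 ∈ Ω then f p / φ p.2 else wf p / wφ p.2, ?_, fun t _ x hx => if_pos hx⟩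
  intro p hp
  by_cases hpΩ : p.2 ∈ Ω
  · refine ((hf p hp).div (hφS p hp) (hpos _ hpΩ).ne').congr_of_eventuallyEq ?_ (if_pos hpΩ)
    have : ∀ᶠ y in nhds p, y.2 ∈ Ω := (hΩ.preimage continuous_snd).mem_nhds hpΩ
    filter_upwards [mem_nhdsWithin_of_mem_nhds this] with y hy using if_pos hy
  · have hpU : p ∈ {p : ℝ × EuclideanSpace ℝ (Fin n) | d p.2 < r₀} := by
      have : d p.2 = 0 := infDist_zero_of_mem (hfrΩ _ hp.2 hpΩ)
      exact this.trans_lt hr₀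
    rw [← contDiffWithinAt_inter (hUo'.mem_nhds hpU)]
    refine (hwf.div (hwφ.comp contDiffOn_snd hmaps) fun y hy => hwφ0 _ (hmaps hy)).congr
      (fun y hy => ?_) p ⟨hp, hpU⟩
    by_cases hyΩ : y.2 ∈ Ω
    · rw [if_pos hyΩ, hfeq y hy, hφeq _ (hmaps hy), mul_div_mul_left _ _ (hdpos _ hyΩ).ne']
      rfl
    · rw [if_neg hyΩ]
      rfl

end Quotient

/-- If `u₁` is a smooth solution of `∂u/∂t = Δu - Vu` on `ℝ₊ × Ω` vanishing on
`ℝ₊ × ∂Ω` and `u₀(t,x) = e^{-λ₀ t} φ₀(x)` is the solution with initial data the ground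
state `φ₀`, then `v = u₁/u₀` extends to a smooth function on `ℝ₊ × Ω̄` satisfying the
drift heat equation `∂v/∂t = Δv + 2⟨∇log φ₀, ∇v⟩` on `ℝ₊ × Ω`. -/
theorem ratio_satisfies_drift_heat_equation
    {n : ℕ} {Ω : Set (EuclideanSpace ℝ (Fin n))}
    (hΩopen : IsOpen Ω) (hΩne : Ω.Nonempty) (hΩbdd : Bornology.IsBounded Ω)
    (hΩconv : StrictConvex ℝ Ω)
    (hΩsmooth : ∃ r₀ > 0, ContDiffOn ℝ (⊤ : ℕ∞) (fun x => Metric.infDist x (frontier Ω))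
      {x ∈ closure Ω | Metric.infDist x (frontier Ω) ≤ r₀})
    {V φ₀ : EuclideanSpace ℝ (Fin n) → ℝ} {lam₀ : ℝ}
    (hV : ContDiffOn ℝ (⊤ : ℕ∞) V (closure Ω))
    (hφ₀smooth : ContDiffOn ℝ (⊤ : ℕ∞) φ₀ (closure Ω))
    (hφ₀pos : ∀ x ∈ Ω, 0 < φ₀ x)
    (hφ₀bd : ∀ x ∈ frontier Ω, φ₀ x = 0)
    (hφ₀eig : ∀ x ∈ Ω, -lap φ₀ x + V x * φ₀ x = lam₀ * φ₀ x)
    {u₁ : ℝ → EuclideanSpace ℝ (Fin n) → ℝ}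
    (hu₁smooth : ContDiffOn ℝ (⊤ : ℕ∞)
      (fun p : ℝ × EuclideanSpace ℝ (Fin n) => u₁ p.1 p.2) (Set.Ici 0 ×ˢ closure Ω))
    (hu₁pde : ∀ t ∈ Set.Ici (0 : ℝ), ∀ x ∈ Ω,
      derivWithin (fun s => u₁ s x) (Set.Ici 0) t = lap (u₁ t) x - V x * u₁ t x)
    (hu₁bd : ∀ t ∈ Set.Ici (0 : ℝ), ∀ x ∈ frontier Ω, u₁ t x = 0) :
    ∃ v : ℝ → EuclideanSpace ℝ (Fin n) → ℝ,
      ContDiffOn ℝ (⊤ : ℕ∞)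
        (fun p : ℝ × EuclideanSpace ℝ (Fin n) => v p.1 p.2) (Set.Ici 0 ×ˢ closure Ω) ∧
      (∀ t ∈ Set.Ici (0 : ℝ), ∀ x ∈ Ω,
        v t x = u₁ t x / (Real.exp (-lam₀ * t) * φ₀ x)) ∧
      (∀ t ∈ Set.Ici (0 : ℝ), ∀ x ∈ Ω,
        derivWithin (fun s => v s x) (Set.Ici 0) t =
          lap (v t) x +
            2 * ⟪gradient (fun z => Real.log (φ₀ z)) x, gradient (v t) x⟫) := by
  have hΩnhds : ∀ x ∈ Ω, closure Ω ∈ nhds x := fun x hx =>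
    Filter.mem_of_superset (hΩopen.mem_nhds hx) subset_closure
  obtain ⟨r₀, hr₀, hd⟩ := hΩsmooth
  obtain ⟨M, hM⟩ := hΩbdd.isCompact_closure.exists_bound_of_continuousOn
    (hV.continuousOn.sub (continuousOn_const (c := lam₀)))
  have hsuper : ∀ x ∈ Ω, lap φ₀ x ≤ |M| * φ₀ x := fun x hx => by
    have h1 : V x - lam₀ ≤ |M| :=
      (le_abs_self _).trans ((hM x (subset_closure hx)).trans (le_abs_self M))
    have h2 := hφ₀eig x hx
    nlinarith [hφ₀pos x hx]
  obtain ⟨q, hq, hqeq⟩ := exists_contDiffOn_eq_div hΩopen hΩne hΩbdd hΩconv.convex hr₀ hd hφ₀smooth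
    hφ₀pos hφ₀bd (abs_nonneg M) hsuper hu₁smooth hu₁bd
  set v : ℝ → EuclideanSpace ℝ (Fin n) → ℝ := fun t x => Real.exp (lam₀ * t) * q (t, x) with hv_def
  have hv : ContDiffOn ℝ (⊤ : ℕ∞) (fun p : ℝ × EuclideanSpace ℝ (Fin n) => v p.1 p.2)
      (Ici 0 ×ˢ closure Ω) :=
    (Real.contDiff_exp.comp (contDiff_const.mul contDiff_fst)).contDiffOn.mul hq
  have hu₁eq : ∀ t ∈ Ici (0 : ℝ), ∀ x ∈ Ω,
      u₁ t x = Real.exp (-lam₀ * t) * (φ₀ x * v t x) := fun t ht x hx => by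
    have h1 : Real.exp (-lam₀ * t) * Real.exp (lam₀ * t) = 1 := by
      rw [← Real.exp_add]; simp
    have h2 := (hφ₀pos x hx).ne'
    simp only [hv_def, hqeq t ht x hx]
    rw [show Real.exp (-lam₀ * t) * (φ₀ x * (Real.exp (lam₀ * t) * (u₁ t x / φ₀ x))) =
      Real.exp (-lam₀ * t) * Real.exp (lam₀ * t) * (φ₀ x * (u₁ t x / φ₀ x)) by ring, h1, one_mul,
      mul_div_cancel₀ _ h2]
  refine ⟨v, hv, fun t ht x hx => ?_, fun t ht x hx => ?_⟩
  · rw [hu₁eq t ht x hx]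
    have h1 := (hφ₀pos x hx).ne'
    have h2 := (Real.exp_pos (-lam₀ * t)).ne'
    field_simp
  have hφpos := hφ₀pos x hx
  have hφ2 : ContDiffAt ℝ 2 φ₀ x := (hφ₀smooth.contDiffAt (hΩnhds x hx)).of_le two_le_infty
  have hv2 : ContDiffAt ℝ 2 (v t) x := by
    have : ContDiffOn ℝ (⊤ : ℕ∞) (v t) (closure Ω) :=
      hv.comp (contDiff_prodMk_right t).contDiffOn fun y hy => ⟨ht, hy⟩
    exact (this.contDiffAt (hΩnhds x hx)).of_le two_le_infty
  have hlap : lap (u₁ t) x = Real.exp (-lam₀ * t) *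
      (φ₀ x * lap (v t) x + v t x * lap φ₀ x + 2 * ⟪gradient φ₀ x, gradient (v t) x⟫) := by
    rw [← lap_mul hφ2 hv2, ← lap_const_mul _ (hφ2.mul hv2)]
    refine lap_congr ?_
    filter_upwards [hΩopen.mem_nhds hx] with y hy using hu₁eq t ht y hy
  have hlog : ⟪gradient (fun z => Real.log (φ₀ z)) x, gradient (v t) x⟫ =
      (φ₀ x)⁻¹ * ⟪gradient φ₀ x, gradient (v t) x⟫ := by
    simp only [inner_gradient_gradient,
      fderiv.log (hφ2.differentiableAt (by simp)) hφpos.ne', smul_apply, smul_eq_mul,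
      Finset.mul_sum, mul_assoc]
  have hvt : HasDerivWithinAt (fun s => v s x) (derivWithin (fun s => v s x) (Ici 0) t) (Ici 0) t := by
    have : ContDiffOn ℝ (⊤ : ℕ∞) (fun s => v s x) (Ici 0) :=
      hv.comp (contDiff_prodMk_left x).contDiffOn fun s hs => ⟨hs, subset_closure hx⟩
    exact (this.differentiableOn (by simp) t ht).hasDerivWithinAt
  have hexp : HasDerivWithinAt (fun s => Real.exp (-lam₀ * s))
      (Real.exp (-lam₀ * t) * -lam₀) (Ici 0) t := by
    simpa using (((hasDerivAt_id t).const_mul (-lam₀)).exp).hasDerivWithinAt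
  have hut := ((hexp.mul (hvt.const_mul (φ₀ x))).congr_of_mem (f₁ := fun s => u₁ s x)
    (fun s hs => hu₁eq s hs x hx) ht).derivWithin (uniqueDiffOn_Ici 0 t ht)
  have hpde := hu₁pde t ht x hx
  rw [hut, hlap, hu₁eq t ht x hx] at hpde
  rw [hlog]
  have heig := hφ₀eig x hx
  have hE := (Real.exp_pos (-lam₀ * t)).ne'
  have key : φ₀ x * derivWithin (fun s => v s x) (Ici 0) t =
      φ₀ x * lap (v t) x + 2 * ⟪gradient φ₀ x, gradient (v t) x⟫ := by
    refine mul_left_cancel₀ hE ?_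
    linear_combination hpde - Real.exp (-lam₀ * t) * v t x * heig
  refine mul_left_cancel₀ hφpos.ne' ?_
  rw [key]
  field_simp
end

section
/- Let Ω ⊂ ℝⁿ be a bounded strictly convex open domain with smooth boundary, and let φ₀, φ₁ be smooth functions on Ω̄ with φ₀ > 0 on Ω, φ₀ = φ₁ = 0 on ∂Ω, and ∇φ₀(x) ≠ 0 for every x ∈ ∂Ω. Then the ratio v₀ = φ₁/φ₀, defined on Ω, extends to a C¹ function on Ω̄; in particular, v₀ is Lipschitz continuous on Ω̄. -/
open Metric Set
open scoped RealInnerProductSpace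
open Filter Topology

section Frontier

variable {E : Type*} [NormedAddCommGroup E] [NormedSpace ℝ E] {Ω : Set E}

lemma Convex.sub_smul_notMem_closure_of_mem_frontier (ho : IsOpen Ω) (hc : Convex ℝ Ω) {x e : E}
    (hx : x ∈ frontier Ω) (he : x + e ∈ Ω) {t : ℝ} (ht : 0 < t) : x - t • e ∉ closure Ω := by
  intro hmem
  have hsub := hc.openSegment_interior_closure_subset_interior
    (by rwa [ho.interior_eq] : x + e ∈ interior Ω) hmem
  refine hx.2 (hsub ⟨t / (1 + t), 1 / (1 + t), by positivity, by positivity, by field_simp; ring, ?_⟩)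
  have h : t / (1 + t) = 1 - 1 / (1 + t) := by field_simp; ring
  rw [smul_add, smul_sub, smul_smul, show 1 / (1 + t) * t = t / (1 + t) by ring, h]
  module

lemma Convex.exists_mem_frontier_sub_smul (ho : IsOpen Ω) (hc : Convex ℝ Ω) {x e : E} (hx : x ∈ Ω)
    {t : ℝ} (ht : 0 < t) (hz : x - t • e ∉ closure Ω) :
    ∃ τ, 0 < τ ∧ τ ≤ t ∧ x - τ • e ∈ frontier Ω ∧ ∀ s, 0 ≤ s → s < τ → x - s • e ∈ Ω := by
  have hpre : IsPreconnected ((fun s : ℝ => x - s • e) '' Icc 0 t) :=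
    isPreconnected_Icc.image _ (by fun_prop)
  obtain ⟨τ, hτ, hfr⟩ : ∃ τ ∈ Icc 0 t, x - τ • e ∈ frontier Ω := by
    by_contra! hcon
    obtain ⟨w, -, hw, hw'⟩ := hpre Ω (closure Ω)ᶜ ho isClosed_closure.isOpen_compl
      (by
        rintro _ ⟨s, hs, rfl⟩
        by_cases h : x - s • e ∈ closure Ω
        · left
          by_contra h'
          exact hcon s hs ⟨h, by rwa [ho.interior_eq]⟩
        · exact Or.inr h)
      ⟨x, ⟨0, ⟨le_rfl, ht.le⟩, by simp⟩, hx⟩ ⟨_, ⟨t, ⟨ht.le, le_rfl⟩, rfl⟩, hz⟩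
    exact hw' (subset_closure hw)
  have hτ0 : 0 < τ := by
    refine lt_of_le_of_ne hτ.1 ?_
    rintro rfl
    rw [ho.frontier_eq] at hfr
    exact hfr.2 (by simpa using hx)
  refine ⟨τ, hτ0, hτ.2, hfr, fun s hs hsτ => ?_⟩
  rcases hs.eq_or_lt with rfl | hs
  · simpa using hx
  have hsub := hc.openSegment_interior_closure_subset_interior
    (by rwa [ho.interior_eq] : x ∈ interior Ω) hfr.1
  rw [ho.interior_eq] at hsub
  refine hsub ⟨1 - s / τ, s / τ, ?_, by positivity, by ring, ?_⟩
  · rw [sub_pos, div_lt_one hτ0]; exact hsτ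
  · have : (s / τ) * τ = s := by field_simp
    rw [smul_sub, smul_smul, this]
    module

/-- L'Hôpital's rule at a boundary point of a convex open set, along a direction pointing inwards. -/
lemma Convex.tendsto_div_of_tendsto_fderivWithin_div (ho : IsOpen Ω) (hc : Convex ℝ Ω) {x₀ e : E}
    (hx₀ : x₀ ∈ frontier Ω) (he : x₀ + e ∈ Ω) {F G : E → ℝ}
    (hF : DifferentiableOn ℝ F (closure Ω)) (hG : DifferentiableOn ℝ G (closure Ω))
    (hF0 : ∀ y ∈ frontier Ω, F y = 0) (hG0 : ∀ y ∈ frontier Ω, G y = 0)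
    (hG' : ∀ᶠ x in 𝓝[Ω] x₀, fderivWithin ℝ G (closure Ω) x e ≠ 0) {l : ℝ}
    (h : Tendsto (fun x => fderivWithin ℝ F (closure Ω) x e / fderivWithin ℝ G (closure Ω) x e)
      (𝓝[Ω] x₀) (𝓝 l)) :
    Tendsto (fun x => F x / G x) (𝓝[Ω] x₀) (𝓝 l) := by
  refine tendsto_def.2 fun U hU => ?_
  obtain ⟨r, hr, hball⟩ := Metric.mem_nhdsWithin_iff.1 (inter_mem (h hU) hG')
  obtain ⟨t, htr, ht⟩ : ∃ t : ℝ, x₀ - t • e ∈ ball x₀ r ∧ 0 < t := by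
    have h1 : Tendsto (fun t : ℝ => x₀ - t • e) (𝓝[>] 0) (𝓝 x₀) := by
      have : Continuous fun t : ℝ => x₀ - t • e := by fun_prop
      simpa using (this.tendsto 0).mono_left nhdsWithin_le_nhds
    exact ((h1.eventually (ball_mem_nhds _ hr)).and self_mem_nhdsWithin).exists
  have hcont : Tendsto (fun x => x - t • e) (𝓝 x₀) (𝓝 (x₀ - t • e)) :=
    (continuous_id.sub continuous_const).tendsto x₀
  have hev : ∀ᶠ x in 𝓝 x₀, x - t • e ∈ ball x₀ r ∩ (closure Ω)ᶜ :=
    hcont.eventually ((isOpen_ball.inter isClosed_closure.isOpen_compl).mem_nhds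
      ⟨htr, hc.sub_smul_notMem_closure_of_mem_frontier ho hx₀ he ht⟩)
  filter_upwards [mem_nhdsWithin_of_mem_nhds hev, mem_nhdsWithin_of_mem_nhds (ball_mem_nhds x₀ hr),
    self_mem_nhdsWithin] with x ⟨hxr, hxz⟩ hxb hxΩ
  obtain ⟨τ, hτ0, hτt, hfr, hin⟩ := hc.exists_mem_frontier_sub_smul ho hxΩ ht hxz
  have hinball : ∀ s, 0 ≤ s → s ≤ t → x - s • e ∈ ball x₀ r := fun s hs hst => by
    refine (convex_ball x₀ r).segment_subset hxb hxr
      ⟨1 - s / t, s / t, ?_, by positivity, by ring, ?_⟩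
    · rw [sub_nonneg, div_le_one ht]; exact hst
    · have : (s / t) * t = s := by field_simp
      rw [smul_sub, smul_smul, this]
      module
  have hcl : ∀ s ∈ Icc 0 τ, x - s • e ∈ closure Ω := fun s hs => by
    rcases hs.2.eq_or_lt with rfl | h'
    · exact hfr.1
    · exact subset_closure (hin s hs.1 h')
  have hline : ∀ s : ℝ, HasDerivAt (fun s : ℝ => x - s • e) (-e) s := fun s => by
    simpa using ((hasDerivAt_id s).smul_const e).const_sub x
  have hlinec : ContinuousOn (fun s : ℝ => x - s • e) (Icc 0 τ) := by fun_prop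
  have hderiv : ∀ H : E → ℝ, DifferentiableOn ℝ H (closure Ω) → ∀ s ∈ Ioo 0 τ,
      HasDerivAt (fun s : ℝ => H (x - s • e))
        (-fderivWithin ℝ H (closure Ω) (x - s • e) e) s := fun H hH s hs => by
    have hm := hin s hs.1.le hs.2
    have := ((hH _ (subset_closure hm)).hasFDerivWithinAt.hasFDerivAt
      (mem_of_superset (ho.mem_nhds hm) subset_closure)).comp_hasDerivAt s (hline s)
    rw [map_neg] at this
    exact this
  have hpt : ∀ c ∈ Ioo 0 τ, fderivWithin ℝ F (closure Ω) (x - c • e) e /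
      fderivWithin ℝ G (closure Ω) (x - c • e) e ∈ U ∧
      fderivWithin ℝ G (closure Ω) (x - c • e) e ≠ 0 := fun c hc' =>
    hball ⟨hinball c hc'.1.le (hc'.2.le.trans hτt), hin c hc'.1.le hc'.2⟩
  obtain ⟨c, hc', hcauchy⟩ := exists_ratio_hasDerivAt_eq_ratio_slope _ _ hτ0
    (hF.continuousOn.comp hlinec hcl) (hderiv F hF) _ _
    (hG.continuousOn.comp hlinec hcl) (hderiv G hG)
  obtain ⟨d, hd, hmean⟩ := exists_hasDerivAt_eq_slope _ _ hτ0
    (hG.continuousOn.comp hlinec hcl) (hderiv G hG)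
  have hGx : G x ≠ 0 := by
    intro h0
    simp [hG0 _ hfr, h0] at hmean
    exact (hpt d hd).2 hmean
  simp only [Function.comp_def, hF0 _ hfr, hG0 _ hfr, zero_smul, sub_zero, zero_sub] at hcauchy
  have : F x / G x = fderivWithin ℝ F (closure Ω) (x - c • e) e /
      fderivWithin ℝ G (closure Ω) (x - c • e) e := by
    rw [div_eq_div_iff hGx (hpt c hc').2]
    linarith
  change F x / G x ∈ U
  rw [this]
  exact (hpt c hc').1

lemma Convex.uniqueDiffOn_closure (ho : IsOpen Ω) (hne : Ω.Nonempty) (hc : Convex ℝ Ω) :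
    UniqueDiffOn ℝ (closure Ω) :=
  uniqueDiffOn_convex hc.closure (hne.mono (interior_maximal subset_closure ho))

/-- The case of L'Hôpital's rule where the limit is given by the derivatives at the point. -/
lemma Convex.tendsto_div_of_fderivWithin_ne_zero (ho : IsOpen Ω) (hc : Convex ℝ Ω) {x₀ e : E}
    (hx₀ : x₀ ∈ frontier Ω) (he : x₀ + e ∈ Ω) {F G : E → ℝ}
    (hF : ContDiffOn ℝ 1 F (closure Ω)) (hG : ContDiffOn ℝ 1 G (closure Ω))
    (hF0 : ∀ y ∈ frontier Ω, F y = 0) (hG0 : ∀ y ∈ frontier Ω, G y = 0)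
    (hG' : fderivWithin ℝ G (closure Ω) x₀ e ≠ 0) :
    Tendsto (fun x => F x / G x) (𝓝[Ω] x₀)
      (𝓝 (fderivWithin ℝ F (closure Ω) x₀ e / fderivWithin ℝ G (closure Ω) x₀ e)) := by
  have hu := hc.uniqueDiffOn_closure ho ⟨_, he⟩
  have hlim : ∀ {H : E → ℝ}, ContDiffOn ℝ 1 H (closure Ω) →
      Tendsto (fun x => fderivWithin ℝ H (closure Ω) x e) (𝓝[Ω] x₀)
        (𝓝 (fderivWithin ℝ H (closure Ω) x₀ e)) := fun hH =>
    (((hH.continuousOn_fderivWithin hu le_rfl).clm_apply continuousOn_const) x₀ hx₀.1).mono_left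
      (nhdsWithin_mono _ subset_closure)
  exact hc.tendsto_div_of_tendsto_fderivWithin_div ho hx₀ he (hF.differentiableOn one_ne_zero)
    (hG.differentiableOn one_ne_zero) hF0 hG0 ((hlim hG).eventually_ne hG')
    ((hlim hF).div (hlim hG) hG')

/-- A function on a convex open set which, together with its derivative, has limits at all points of
the closure extends to a `C¹` function on the closure. -/
lemma Convex.contDiffOn_extendFrom (ho : IsOpen Ω) (hne : Ω.Nonempty) (hc : Convex ℝ Ω) {f : E → ℝ}
    (hf : DifferentiableOn ℝ f Ω)
    (hlim : ∀ x ∈ closure Ω, ∃ l, Tendsto f (𝓝[Ω] x) (𝓝 l))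
    (hlim' : ∀ x ∈ closure Ω, ∃ L, Tendsto (fderiv ℝ f) (𝓝[Ω] x) (𝓝 L)) :
    ContDiffOn ℝ 1 (extendFrom Ω f) (closure Ω) := by
  have heq : EqOn (extendFrom Ω f) f Ω := extendFrom_extends hf.continuousOn
  have hcont := continuousOn_extendFrom subset_rfl hlim
  have hcont' := continuousOn_extendFrom subset_rfl hlim'
  have hder : ∀ x ∈ closure Ω,
      HasFDerivWithinAt (extendFrom Ω f) (extendFrom Ω (fderiv ℝ f) x) (closure Ω) x := fun x hx => by
    refine hasFDerivWithinAt_closure_of_tendsto_fderiv (hf.congr heq) hc ho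
      (fun y hy => (hcont y hy).mono subset_closure) ?_
    refine (tendsto_extendFrom (hlim' x hx)).congr' ?_
    filter_upwards [self_mem_nhdsWithin] with y hy
    exact ((heq.eventuallyEq_of_mem (ho.mem_nhds hy)).fderiv_eq).symm
  rw [show (1 : WithTop ℕ∞) = 0 + 1 from (zero_add 1).symm,
    contDiffOn_succ_iff_hasFDerivWithinAt_of_uniqueDiffOn (hc.uniqueDiffOn_closure ho hne)]
  exact ⟨by simp, _, contDiffOn_zero.2 hcont', hder⟩

lemma ContDiffOn.exists_lipschitzOnWith_of_isCompact {f : E → ℝ} {s : Set E}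
    (hf : ContDiffOn ℝ 1 f s) (hs : IsCompact s) (hc : Convex ℝ s) (hu : UniqueDiffOn ℝ s) :
    ∃ K : NNReal, LipschitzOnWith K f s := by
  obtain ⟨C, hC⟩ := hs.exists_bound_of_continuousOn (hf.continuousOn_fderivWithin hu le_rfl)
  refine ⟨C.toNNReal, hc.lipschitzOnWith_of_nnnorm_fderivWithin_le
    (hf.differentiableOn one_ne_zero) fun x hx => ?_⟩
  exact NNReal.le_toNNReal_of_coe_le (hC x hx)

lemma ContinuousLinearMap.pos_of_nonneg_sub (ho : IsOpen Ω) {A : StrongDual ℝ E} (hA : A ≠ 0)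
    {x p : E} (hp : p ∈ Ω) (h : ∀ q ∈ Ω, 0 ≤ A (q - x)) : 0 < A (p - x) := by
  have hsub : A '' Ω ⊆ Ici (A x) := by
    rintro _ ⟨q, hq, rfl⟩
    simpa using h q hq
  have := interior_maximal hsub (A.isOpenMap_of_ne_zero hA _ ho) (mem_image_of_mem A hp)
  rw [interior_Ici] at this
  simpa using this

lemma ContinuousLinearMap.eq_zero_of_apply_sub_eq_zero (ho : IsOpen Ω) (hne : Ω.Nonempty)
    {A : StrongDual ℝ E} {x : E} (h : ∀ q ∈ Ω, A (q - x) = 0) : A = 0 := by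
  by_contra hA
  obtain ⟨p, hp⟩ := hne
  simpa [h p hp] using A.pos_of_nonneg_sub ho hA hp fun q hq => (h q hq).ge

lemma Convex.fderivWithin_sub_pos (ho : IsOpen Ω) (hc : Convex ℝ Ω) {f : E → ℝ} {x p : E}
    (hx : x ∈ frontier Ω) (hp : p ∈ Ω) (hf : DifferentiableWithinAt ℝ f (closure Ω) x)
    (hmin : ∀ y ∈ closure Ω, f x ≤ f y) (hne : fderivWithin ℝ f (closure Ω) x ≠ 0) :
    0 < fderivWithin ℝ f (closure Ω) x (p - x) := by
  refine ContinuousLinearMap.pos_of_nonneg_sub ho hne hp fun q hq => ?_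
  exact IsLocalMinOn.hasFDerivWithinAt_nonneg (eventually_mem_nhdsWithin.mono hmin)
    hf.hasFDerivWithinAt (sub_mem_posTangentConeAt_of_segment_subset
      (hc.closure.segment_subset hx.1 (subset_closure hq)))

/-- If `g` vanishes on the frontier, its derivative there is proportional to that of `f`. -/
lemma Convex.exists_fderivWithin_eq_smul (ho : IsOpen Ω) (hne : Ω.Nonempty) (hc : Convex ℝ Ω)
    {f g : E → ℝ} {x : E} (hx : x ∈ frontier Ω)
    (hf : ContDiffOn ℝ 1 f (closure Ω)) (hg : ContDiffOn ℝ 1 g (closure Ω))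
    (hf0 : ∀ y ∈ frontier Ω, f y = 0) (hg0 : ∀ y ∈ frontier Ω, g y = 0)
    (hpos : ∀ p ∈ Ω, 0 < fderivWithin ℝ f (closure Ω) x (p - x)) :
    ∃ c : ℝ, fderivWithin ℝ g (closure Ω) x = c • fderivWithin ℝ f (closure Ω) x := by
  obtain ⟨p, hp⟩ := hne
  have hlim : ∀ q ∈ Ω, Tendsto (fun y => g y / f y) (𝓝[Ω] x)
      (𝓝 (fderivWithin ℝ g (closure Ω) x (q - x) / fderivWithin ℝ f (closure Ω) x (q - x))) :=
    fun q hq => hc.tendsto_div_of_fderivWithin_ne_zero ho hx (by simpa using hq) hg hf hg0 hf0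
      (hpos q hq).ne'
  have := mem_closure_iff_nhdsWithin_neBot.1 hx.1
  refine ⟨fderivWithin ℝ g (closure Ω) x (p - x) / fderivWithin ℝ f (closure Ω) x (p - x),
    sub_eq_zero.1 (ContinuousLinearMap.eq_zero_of_apply_sub_eq_zero ho ⟨p, hp⟩ (x := x)
      fun q hq => ?_)⟩
  rw [tendsto_nhds_unique (hlim p hp) (hlim q hq), sub_apply,
    smul_apply, smul_eq_mul, div_mul_cancel₀ _ (hpos q hq).ne', sub_self]

/-- If the numerator vanishes to second order on the frontier and the denominator is the square of a
defining function, the quotient has limits at frontier points. -/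
lemma Convex.exists_tendsto_div_sq (ho : IsOpen Ω) (hc : Convex ℝ Ω) {x₀ e : E}
    (hx₀ : x₀ ∈ frontier Ω) (he : x₀ + e ∈ Ω) {f N : E → ℝ}
    (hf : ContDiffOn ℝ 2 f (closure Ω)) (hN : ContDiffOn ℝ 2 N (closure Ω))
    (hf0 : ∀ y ∈ frontier Ω, f y = 0) (hN0 : ∀ y ∈ frontier Ω, N y = 0)
    (hN0' : ∀ y ∈ frontier Ω, fderivWithin ℝ N (closure Ω) y = 0)
    (hfpos : ∀ y ∈ Ω, 0 < f y)
    (hf' : fderivWithin ℝ f (closure Ω) x₀ e ≠ 0) :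
    ∃ l, Tendsto (fun x => N x / f x ^ 2) (𝓝[Ω] x₀) (𝓝 l) := by
  have hu := hc.uniqueDiffOn_closure ho ⟨_, he⟩
  set K := closure Ω
  have hD : ∀ {H : E → ℝ}, ContDiffOn ℝ 2 H K → ContDiffOn ℝ 1 (fun x => fderivWithin ℝ H K x e) K :=
    fun hH => (hH.fderivWithin hu (by norm_num)).clm_apply contDiffOn_const
  have hd : ∀ {H : E → ℝ}, ContDiffOn ℝ 2 H K → DifferentiableOn ℝ H K :=
    fun hH => hH.differentiableOn two_ne_zero
  have hlimf' : Tendsto (fun x => fderivWithin ℝ f K x e) (𝓝[Ω] x₀) (𝓝 (fderivWithin ℝ f K x₀ e)) :=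
    ((hD hf).continuousOn x₀ hx₀.1).mono_left (nhdsWithin_mono _ subset_closure)
  have hsq : ∀ x ∈ K, fderivWithin ℝ (fun x => f x ^ 2) K x e =
      2 * (f x * fderivWithin ℝ f K x e) := fun x hx => by
    rw [(((hd hf) x hx).hasFDerivWithinAt.pow 2).fderivWithin (hu x hx)]
    simp
    ring
  have hG : ContDiffOn ℝ 1 (fun x => 2 * (f x * fderivWithin ℝ f K x e)) K :=
    contDiffOn_const.mul ((hf.of_le (by norm_num)).mul (hD hf))
  have hG' : fderivWithin ℝ (fun x => 2 * (f x * fderivWithin ℝ f K x e)) K x₀ e ≠ 0 := by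
    rw [(((((hd hf) x₀ hx₀.1).hasFDerivWithinAt.fun_mul
      ((hD hf).differentiableOn one_ne_zero x₀ hx₀.1).hasFDerivWithinAt)).const_mul 2).fderivWithin
      (hu x₀ hx₀.1)]
    simpa [hf0 x₀ hx₀] using hf'
  refine ⟨fderivWithin ℝ (fun x => fderivWithin ℝ N K x e) K x₀ e /
    fderivWithin ℝ (fun x => 2 * (f x * fderivWithin ℝ f K x e)) K x₀ e,
    hc.tendsto_div_of_tendsto_fderivWithin_div ho hx₀ he (hd hN) (hd (hf.pow 2)) hN0
    (fun y hy => by simp [hf0 y hy]) ?_ ?_⟩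
  · filter_upwards [hlimf'.eventually_ne hf', self_mem_nhdsWithin] with x hx hxΩ
    rw [hsq x (subset_closure hxΩ)]
    exact mul_ne_zero two_ne_zero (mul_ne_zero (hfpos x hxΩ).ne' hx)
  · refine (hc.tendsto_div_of_fderivWithin_ne_zero ho hx₀ he (hD hN) hG
      (fun y hy => ?_) (fun y hy => ?_) hG').congr' ?_
    · simp [K, hN0' y hy]
    · simp [hf0 y hy]
    · filter_upwards [self_mem_nhdsWithin] with x hx
      rw [hsq x (subset_closure hx)]

/-- In finite dimension, convergence of linear forms can be checked pointwise. -/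
lemma exists_tendsto_clm_of_forall_apply [FiniteDimensional ℝ E] {α : Type*} {l : Filter α}
    {A : α → StrongDual ℝ E} (h : ∀ w, ∃ c, Tendsto (fun a => A a w) l (𝓝 c)) :
    ∃ L, Tendsto A l (𝓝 L) := by
  let b := Module.finBasis ℝ E
  choose c hc using h
  refine ⟨∑ i, c (b i) • (b.coord i).toContinuousLinearMap, ?_⟩
  have : A = fun a => ∑ i, A a (b i) • (b.coord i).toContinuousLinearMap := by
    funext a
    ext w
    conv_lhs => rw [← b.sum_repr w]
    simp [-Module.Basis.sum_repr, mul_comm]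
  rw [this]
  exact tendsto_finsetSum _ fun i _ => (hc (b i)).smul_const _

/-- The quotient of two functions vanishing on the frontier of a convex open set, the denominator
being a defining function, extends to a `C¹` function on the closure. -/
lemma Convex.contDiffOn_extendFrom_div [FiniteDimensional ℝ E] (ho : IsOpen Ω) (hne : Ω.Nonempty)
    (hc : Convex ℝ Ω) {f g : E → ℝ}
    (hf : ContDiffOn ℝ 3 f (closure Ω)) (hg : ContDiffOn ℝ 3 g (closure Ω))
    (hfpos : ∀ x ∈ Ω, 0 < f x)
    (hf0 : ∀ y ∈ frontier Ω, f y = 0) (hg0 : ∀ y ∈ frontier Ω, g y = 0)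
    (hf' : ∀ y ∈ frontier Ω, fderivWithin ℝ f (closure Ω) y ≠ 0) :
    ContDiffOn ℝ 1 (extendFrom Ω fun x => g x / f x) (closure Ω) := by
  have hu := hc.uniqueDiffOn_closure ho hne
  obtain ⟨p, hp⟩ := hne
  have hcl : closure Ω = Ω ∪ frontier Ω := by
    rw [closure_eq_interior_union_frontier, ho.interior_eq]
  have hd : ∀ {H : E → ℝ}, ContDiffOn ℝ 3 H (closure Ω) → DifferentiableOn ℝ H (closure Ω) :=
    fun hH => hH.differentiableOn three_ne_zero
  have h1 : ∀ {H : E → ℝ}, ContDiffOn ℝ 3 H (closure Ω) → ContDiffOn ℝ 1 H (closure Ω) :=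
    fun hH => hH.of_le (by norm_num)
  have h2 : ∀ {H : E → ℝ}, ContDiffOn ℝ 3 H (closure Ω) → ContDiffOn ℝ 2 H (closure Ω) :=
    fun hH => hH.of_le (by norm_num)
  have hD : ∀ {H : E → ℝ}, ContDiffOn ℝ 3 H (closure Ω) → ∀ w,
      ContDiffOn ℝ 2 (fun x => fderivWithin ℝ H (closure Ω) x w) (closure Ω) :=
    fun hH w => (hH.fderivWithin hu (by norm_num)).clm_apply contDiffOn_const
  have hpos : ∀ y ∈ frontier Ω, ∀ q ∈ Ω, 0 < fderivWithin ℝ f (closure Ω) y (q - y) :=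
    fun y hy q hq => by
      refine hc.fderivWithin_sub_pos ho hy hq (hd hf y hy.1) (fun z hz => ?_) (hf' y hy)
      rw [hf0 y hy]
      rw [hcl] at hz
      rcases hz with hz | hz
      · exact (hfpos z hz).le
      · exact (hf0 z hz).ge
  have hsmooth : ContDiffOn ℝ 1 (fun x => g x / f x) Ω :=
    ((h1 hg).mono subset_closure).div ((h1 hf).mono subset_closure) fun x hx => (hfpos x hx).ne'
  refine hc.contDiffOn_extendFrom ho ⟨p, hp⟩ (hsmooth.differentiableOn one_ne_zero)
    (fun x hx => ?_) (fun x hx => ?_)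
  · rw [hcl] at hx
    rcases hx with hx | hx
    · exact ⟨_, hsmooth.continuousOn x hx⟩
    · exact ⟨_, hc.tendsto_div_of_fderivWithin_ne_zero ho hx (e := p - x) (by simpa using hp)
        (h1 hg) (h1 hf) hg0 hf0 (hpos x hx p hp).ne'⟩
  rw [hcl] at hx
  rcases hx with hx | hx
  · exact ⟨_, hsmooth.continuousOn_fderiv_of_isOpen ho le_rfl x hx⟩
  refine exists_tendsto_clm_of_forall_apply fun w => ?_
  obtain ⟨l, hl⟩ := hc.exists_tendsto_div_sq ho hx (e := p - x) (by simpa using hp) (h2 hf)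
    (N := fun z => f z * fderivWithin ℝ g (closure Ω) z w - g z * fderivWithin ℝ f (closure Ω) z w)
    (((h2 hf).mul (hD hg w)).sub ((h2 hg).mul (hD hf w))) hf0
    (fun y hy => by simp [hf0 y hy, hg0 y hy])
    (fun y hy => by
      obtain ⟨c, hcy⟩ := hc.exists_fderivWithin_eq_smul ho ⟨p, hp⟩ hy (h1 hf) (h1 hg) hf0 hg0
        (hpos y hy)
      rw [((((hd hf) y hy.1).hasFDerivWithinAt.fun_mul
        ((hD hg w).differentiableOn two_ne_zero y hy.1).hasFDerivWithinAt).fun_sub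
        (((hd hg) y hy.1).hasFDerivWithinAt.fun_mul
        ((hD hf w).differentiableOn two_ne_zero y hy.1).hasFDerivWithinAt)).fderivWithin
        (hu y hy.1)]
      ext v
      simp [hf0 y hy, hg0 y hy, hcy]
      ring)
    hfpos (hpos x hx p hp).ne'
  refine ⟨l, hl.congr' ?_⟩
  filter_upwards [self_mem_nhdsWithin] with y hy
  have hnhds : closure Ω ∈ 𝓝 y := mem_of_superset (ho.mem_nhds hy) subset_closure
  have hfy := (hd hf y (subset_closure hy)).hasFDerivWithinAt.hasFDerivAt hnhds
  have hgy := (hd hg y (subset_closure hy)).hasFDerivWithinAt.hasFDerivAt hnhds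
  have hfne := (hfpos y hy).ne'
  have hdiv := hgy.fun_mul ((hasDerivAt_inv hfne).comp_hasFDerivAt y hfy)
  simp only [Function.comp_apply, ← div_eq_mul_inv] at hdiv
  rw [hdiv.fderiv]
  simp
  field_simp
  ring

end Frontier


/-- If `Ω ⊂ ℝⁿ` is a bounded strictly convex open domain with smooth boundary, and
`φ₀, φ₁` are smooth on `Ω̄` with `φ₀ > 0` on `Ω`, `φ₀ = φ₁ = 0` on `∂Ω` and `∇φ₀ ≠ 0` on
`∂Ω`, then `v₀ = φ₁/φ₀` extends to a `C¹` function on `Ω̄`; in particular it is Lipschitz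
continuous on `Ω̄`. -/
theorem ratio_extends_C1_and_Lipschitz
    {n : ℕ} {Ω : Set (EuclideanSpace ℝ (Fin n))}
    (hΩopen : IsOpen Ω) (hΩne : Ω.Nonempty) (hΩbdd : Bornology.IsBounded Ω)
    (hΩconv : StrictConvex ℝ Ω)
    (hΩsmooth : ∃ r₀ > 0, ContDiffOn ℝ (⊤ : ℕ∞) (fun x => Metric.infDist x (frontier Ω))
      {x ∈ closure Ω | Metric.infDist x (frontier Ω) ≤ r₀})
    {φ₀ φ₁ : EuclideanSpace ℝ (Fin n) → ℝ}
    (hφ₀smooth : ContDiffOn ℝ (⊤ : ℕ∞) φ₀ (closure Ω))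
    (hφ₁smooth : ContDiffOn ℝ (⊤ : ℕ∞) φ₁ (closure Ω))
    (hφ₀pos : ∀ x ∈ Ω, 0 < φ₀ x)
    (hφ₀bd : ∀ x ∈ frontier Ω, φ₀ x = 0)
    (hφ₁bd : ∀ x ∈ frontier Ω, φ₁ x = 0)
    (hφ₀grad : ∀ x ∈ frontier Ω, ∀ g : EuclideanSpace ℝ (Fin n),
      HasGradientWithinAt φ₀ g (closure Ω) x → g ≠ 0) :
    ∃ v₀ : EuclideanSpace ℝ (Fin n) → ℝ,
      ContDiffOn ℝ 1 v₀ (closure Ω) ∧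
      (∀ x ∈ Ω, v₀ x = φ₁ x / φ₀ x) ∧
      ∃ K : NNReal, LipschitzOnWith K v₀ (closure Ω) := by
  have hc := hΩconv.convex
  have hu := hc.uniqueDiffOn_closure hΩopen hΩne
  have h3 : (3 : WithTop ℕ∞) ≤ ((⊤ : ℕ∞) : WithTop ℕ∞) :=
    WithTop.coe_le_coe.2 (le_top : (3 : ℕ∞) ≤ ⊤)
  have hC1 := hc.contDiffOn_extendFrom_div hΩopen hΩne (hφ₀smooth.of_le h3) (hφ₁smooth.of_le h3)
    hφ₀pos hφ₀bd hφ₁bd fun y hy h0 => by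
      have hd := (hφ₀smooth.differentiableOn (by simp) y hy.1).hasFDerivWithinAt
      rw [h0] at hd
      exact hφ₀grad y hy _ hd.hasGradientWithinAt (by simp)
  refine ⟨_, hC1, extendFrom_extends ?_, hC1.exists_lipschitzOnWith_of_isCompact
    hΩbdd.isCompact_closure hc.closure hu⟩
  exact (hφ₁smooth.continuousOn.mono subset_closure).div
    (hφ₀smooth.continuousOn.mono subset_closure) fun x hx => (hφ₀pos x hx).ne'
end
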